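/- For every countable family (G_i)_{i∈ℕ} of finitely generated left-orderable groups there exists a finitely generated left-orderable simple group H such that every G_i admits an embedding into H that is simultaneously quasi-isometric and Frattini (with respect to suitable finite generating sets of G_i and H). -/

import Mathlib

-- The sign (−1, 0, or 1) of a group element relative to the identity,
-- with respect to a linear order `l`.
open Classical in
noncomputable def orderSign {H : Type*} [Group H] (l : LinearOrder H) (h : H) : ℤ :=
  if l.lt h 1 then -1 else if h = 1 then 0 else 1

/-- A group is left-orderable if it carries a left-invariant linear order. -/
def IsLeftOrderable (G : Type*) [Group G] : Prop :=
  ∃ l : LinearOrder G, ∀ a b c : G, l.le b c → l.le (a * b) (a * c)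

/-- A Frattini embedding: an injective homomorphism preserving and reflecting conjugacy. -/
def IsFrattini {G H : Type*} [Group G] [Group H] (φ : G →* H) : Prop :=
  Function.Injective φ ∧ ∀ a b : G, IsConj a b ↔ IsConj (φ a) (φ b)

/-- `X` is a (finite) generating set of the group. -/
def Generates {G : Type*} [Group G] (X : Finset G) : Prop :=
  Subgroup.closure (X : Set G) = ⊤

/-- Word length of `g` with respect to the finite set `X`: the least length of a word
over `X ∪ X⁻¹` representing `g`. -/
noncomputable def wordLength {G : Type*} [Group G] (X : Finset G) (g : G) : ℕ :=
  sInf {n | ∃ w : List G, w.length = n ∧ (∀ a ∈ w, a ∈ X ∨ a⁻¹ ∈ X) ∧ w.prod = g}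

/-- Quasi-isometric embedding with respect to finite generating sets `X` and `Y`. -/
noncomputable def IsQIEmbedding {G H : Type*} [Group G] [Group H]
    (X : Finset G) (Y : Finset H) (φ : G →* H) : Prop :=
  Function.Injective φ ∧ ∃ C k : ℝ, 0 < C ∧ 0 < k ∧ ∀ g : G,
    (1 / C) * (wordLength X g : ℝ) - k ≤ (wordLength Y (φ g) : ℝ) ∧
    (wordLength Y (φ g) : ℝ) ≤ C * (wordLength X g : ℝ) + k

/-- Evaluation of a formal word (list of pairs (index, sign)) over the
enumerated sequence `x : ℕ → G`. -/
def evalWord {G : Type*} [Group G] (x : ℕ → G) (w : List (ℕ × Bool)) : G :=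
  (w.map (fun p => if p.2 then x p.1 else (x p.1)⁻¹)).prod

/-- A computable left order on a countable group with respect to an enumerated
generating sequence `x : ℕ → G`. -/
def ComputableLeftOrderWrt {G : Type*} [Group G] (x : ℕ → G) : Prop :=
  ∃ l : LinearOrder G, (∀ a b c : G, l.le b c → l.le (a * b) (a * c)) ∧
    Computable (fun w : List (ℕ × Bool) => orderSign l (evalWord x w))

/-- A computable left order on a finitely generated group, presented by
a surjection `π` from a free group of finite rank. -/
def ComputableLeftOrderVia {H : Type*} [Group H] {m : ℕ}
    (π : FreeGroup (Fin m) →* H) : Prop :=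
  ∃ l : LinearOrder H, (∀ a b c : H, l.le b c → l.le (a * b) (a * c)) ∧
    Computable (fun w : List (Fin m × Bool) => orderSign l (π (FreeGroup.mk w)))

/-- The embedding `φ` is computable: one can compute, for each `i`, a word over the
generators of `H` representing `φ (x i)`. -/
def ComputableEmbedding {G H : Type*} [Group G] [Group H] (x : ℕ → G) {m : ℕ}
    (π : FreeGroup (Fin m) →* H) (φ : G →* H) : Prop :=
  ∃ f : ℕ → List (Fin m × Bool), Computable f ∧ ∀ i, π (FreeGroup.mk (f i)) = φ (x i)

/-- Decidable membership problem for the image of `φ` in `H`, presented via `π`. -/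
def DecidableMembership {G H : Type*} [Group G] [Group H] {m : ℕ}
    (π : FreeGroup (Fin m) →* H) (φ : G →* H) : Prop :=
  ComputablePred (fun w : List (Fin m × Bool) => π (FreeGroup.mk w) ∈ φ.range)

/-- Decidable word problem for `H`, presented via `π`. -/
def DecidableWordProblemVia {H : Type*} [Group H] {m : ℕ}
    (π : FreeGroup (Fin m) →* H) : Prop :=
  ComputablePred (fun w : List (Fin m × Bool) => π (FreeGroup.mk w) = 1)

/-- A group is finitely presented: quotient of a finite-rank free group by the
normal closure of finitely many relators. -/
def IsFinitelyPresented (K : Type*) [Group K] : Prop :=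
  ∃ (m : ℕ) (π : FreeGroup (Fin m) →* K) (R : Finset (FreeGroup (Fin m))),
    Function.Surjective π ∧ π.ker = Subgroup.normalClosure (R : Set (FreeGroup (Fin m)))



namespace FL

/-- Points of the space on which everything acts. -/
abbrev T := List ℚ
abbrev Au := T ≃o T
abbrev Qa := ℚ ≃o ℚ

theorem mk_iso {α : Type*} [LinearOrder α] (f g : α → α) (hf : StrictMono f) (hg : ∀ x, f (g x) = x) :
    ∃ F : α ≃o α, ∀ x, F x = f x :=
  ⟨hf.orderIsoOfRightInverse f g hg, fun _ => rfl⟩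

theorem au_ext {α : Type*} [LinearOrder α] {f g : α ≃o α} (h : ∀ x, f x = g x) : f = g :=
  DFunLike.ext _ _ h

theorem inv_apply_of {α : Type*} [LinearOrder α] {f : α ≃o α} {x y : α} (h : f x = y) : f⁻¹ y = x := by
  rw [← h]; simp

theorem app_nil (f : Au) : f [] = [] := by
  have h1 : f [] ≤ f (f⁻¹ []) := f.monotone (by
    rcases f⁻¹ [] with _ | ⟨a, l⟩
    · exact le_refl _
    · exact (List.nil_lt_cons a l).le)
  rw [RelIso.apply_inv_self] at h1
  rcases h : f [] with _ | ⟨a, l⟩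
  · rfl
  · rw [h] at h1
    exact absurd h1 (not_le.mpr (List.nil_lt_cons a l))

theorem app_ne_nil (f : Au) {u : T} (hu : u ≠ []) : f u ≠ [] := by
  intro h
  rw [← app_nil f] at h
  exact hu (f.injective h)

theorem app_cons (f : Au) (r : ℚ) (v : T) : ∃ r' v', f (r :: v) = r' :: v' := by
  rcases h : f (r :: v) with _ | ⟨a, l⟩
  · exact absurd h (app_ne_nil f (by simp))
  · exact ⟨a, l, rfl⟩

theorem cons_lt {a b : ℚ} {l m : T} : a :: l < b :: m ↔ a < b ∨ a = b ∧ l < m :=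
  List.cons_lt_cons_iff

theorem cons_le {a b : ℚ} {l m : T} : a :: l ≤ b :: m ↔ a < b ∨ a = b ∧ l ≤ m := by
  rw [← not_lt, cons_lt, ← not_lt (a := m) (b := l)]
  rcases lt_trichotomy a b with h | rfl | h
  · simp [h, h.not_gt, h.ne']
  · simp
  · simp [h, h.not_gt, h.ne']

theorem nil_le (l : T) : ([] : T) ≤ l := by
  cases l with
  | nil => exact le_refl _
  | cons a l => exact (List.nil_lt_cons a l).le

/-! ### lift and fib -/

def liftFun (m : ℚ → ℚ) : T → T
  | [] => []
  | a :: w => m a :: w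

theorem liftFun_mono (m : Qa) : StrictMono (liftFun m) := by
  rintro (_ | ⟨a, l⟩) (_ | ⟨b, l'⟩) h
  · exact absurd h (lt_irrefl _)
  · exact List.nil_lt_cons _ _
  · exact absurd h (not_lt.mpr (nil_le _))
  · rw [cons_lt] at h
    simp only [liftFun]
    rw [cons_lt]
    rcases h with h | ⟨rfl, h⟩
    · exact Or.inl (m.strictMono h)
    · exact Or.inr ⟨rfl, h⟩

noncomputable def lift : Qa →* Au where
  toFun m := (liftFun_mono m).orderIsoOfRightInverse (liftFun m) (liftFun (m⁻¹ : Qa)) (by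
    rintro (_ | ⟨a, l⟩) <;> simp [liftFun])
  map_one' := au_ext (by rintro (_ | ⟨a, l⟩) <;> rfl)
  map_mul' f g := au_ext (by rintro (_ | ⟨a, l⟩) <;> rfl)

@[simp] theorem lift_cons (m : Qa) (a : ℚ) (w : T) : lift m (a :: w) = m a :: w := rfl

def fibFun (β : ℚ → T → T) : T → T
  | [] => []
  | a :: w => a :: β a w

theorem fibFun_mono (β : ℚ → Au) : StrictMono (fibFun (fun r => β r)) := by
  rintro (_ | ⟨a, l⟩) (_ | ⟨b, l'⟩) h
  · exact absurd h (lt_irrefl _)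
  · exact List.nil_lt_cons _ _
  · exact absurd h (not_lt.mpr (nil_le _))
  · rw [cons_lt] at h
    simp only [fibFun]
    rw [cons_lt]
    rcases h with h | ⟨rfl, h⟩
    · exact Or.inl h
    · exact Or.inr ⟨rfl, (β a).strictMono h⟩

noncomputable def fib : (ℚ → Au) →* Au where
  toFun β := (fibFun_mono β).orderIsoOfRightInverse (fibFun (fun r => β r))
    (fibFun (fun r => ((β r)⁻¹ : Au))) (by
    rintro (_ | ⟨a, l⟩) <;> simp [fibFun])
  map_one' := au_ext (by rintro (_ | ⟨a, l⟩) <;> rfl)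
  map_mul' f g := au_ext (by rintro (_ | ⟨a, l⟩) <;> rfl)

@[simp] theorem fib_cons (β : ℚ → Au) (a : ℚ) (w : T) : fib β (a :: w) = a :: β a w := rfl

theorem ext_cons {f g : Au} (h : ∀ r v, f (r :: v) = g (r :: v)) : f = g := by
  apply au_ext
  rintro (_ | ⟨r, v⟩)
  · rw [app_nil, app_nil]
  · exact h r v

theorem lift_inv_cons (m : Qa) (a : ℚ) (w : T) : (lift m)⁻¹ (a :: w) = m⁻¹ a :: w := by
  rw [← map_inv]; rfl

theorem fib_inv_cons (β : ℚ → Au) (a : ℚ) (w : T) : (fib β)⁻¹ (a :: w) = a :: (β a)⁻¹ w := by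
  rw [← map_inv]; rfl

theorem lift_fib (m : Qa) (β : ℚ → Au) :
    lift m * fib β * (lift m)⁻¹ = fib (fun r => β (m⁻¹ r)) := by
  apply ext_cons
  intro r v
  rw [RelIso.mul_apply, RelIso.mul_apply, lift_inv_cons, fib_cons, lift_cons, fib_cons]
  simp

/-! ### translations -/

def tr (d : ℚ) : Qa := OrderIso.addRight d

@[simp] theorem tr_apply (d r : ℚ) : tr d r = r + d := rfl

noncomputable def sh (d : ℚ) : Au := lift (tr d)

@[simp] theorem sh_cons (d r : ℚ) (v : T) : sh d (r :: v) = (r + d) :: v := rfl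

theorem sh_append (d : ℚ) {u : T} (hu : u ≠ []) (v : T) : sh d (u ++ v) = sh d u ++ v := by
  cases u with
  | nil => exact absurd rfl hu
  | cons a u => rfl

theorem lift_append (m : Qa) {u : T} (hu : u ≠ []) (v : T) : lift m (u ++ v) = lift m u ++ v := by
  cases u with
  | nil => exact absurd rfl hu
  | cons a u => rfl

theorem sh_add (a b : ℚ) : sh (a + b) = sh a * sh b := by
  apply ext_cons
  intro r v
  simp [add_comm, add_left_comm]

theorem sh_zero : sh 0 = 1 := by
  apply ext_cons
  intro r v
  simp

theorem sh_neg (a : ℚ) : sh (-a) = (sh a)⁻¹ := by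
  rw [eq_inv_iff_mul_eq_one, ← sh_add]
  simp [sh_zero]

theorem sh_comm (a b : ℚ) : sh a * sh b = sh b * sh a := by
  rw [← sh_add, ← sh_add, add_comm]

theorem sh_nat (a : ℚ) (n : ℕ) : sh (a * n) = sh a ^ n := by
  induction n with
  | zero => simp [sh_zero]
  | succ n ih => rw [pow_succ, ← ih, ← sh_add]; congr 1; push_cast; ring

theorem sh_int (a : ℚ) (n : ℤ) : sh (a * n) = sh a ^ n := by
  rcases Int.eq_nat_or_neg n with ⟨k, rfl | rfl⟩
  · rw [zpow_natCast, ← sh_nat]; congr 1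
  · rw [zpow_neg, zpow_natCast, ← sh_nat, ← sh_neg]; congr 1; push_cast; ring

theorem sh_fib (d : ℚ) (β : ℚ → Au) :
    sh d * fib β * (sh d)⁻¹ = fib (fun r => β (r - d)) := by
  rw [sh, lift_fib]
  have : ∀ r, (tr d)⁻¹ r = r - d := fun r => inv_apply_of (by simp)
  simp [this]

/-! ### support in heads -/

def InH (I : Set ℚ) : Subgroup Au where
  carrier := {f | ∀ r v, r ∉ I → f (r :: v) = r :: v}
  one_mem' := fun _ _ _ => rfl
  mul_mem' := by
    intro a b ha hb r v hr
    rw [RelIso.mul_apply, hb r v hr, ha r v hr]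
  inv_mem' := by
    intro a ha r v hr
    exact inv_apply_of (ha r v hr)

theorem InH.mono {I J : Set ℚ} (h : I ⊆ J) {f : Au} (hf : f ∈ InH I) : f ∈ InH J :=
  fun r v hr => hf r v (fun h' => hr (h h'))

theorem InH.app {I : Set ℚ} {f : Au} (hf : f ∈ InH I) {r : ℚ} (hr : r ∈ I) (v : T) :
    ∃ r' ∈ I, ∃ v', f (r :: v) = r' :: v' := by
  obtain ⟨r', v', h⟩ := app_cons f r v
  refine ⟨r', ?_, v', h⟩
  by_contra hn
  have h2 := hf r' v' hn
  rw [← h2] at h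
  have := f.injective h
  simp only [List.cons.injEq] at this
  exact hn (this.1 ▸ hr)

/-! ### PL maps -/

theorem kink_ex (c s : ℚ) (hs : 0 < s) : ∃ f : Qa, ∀ r, f r = if r ≤ c then r else c + s * (r - c) := by
  apply mk_iso _ (fun r => if r ≤ c then r else c + s⁻¹ * (r - c))
  · intro a b h
    have := mul_lt_mul_of_pos_left h hs
    beta_reduce
    split_ifs with h1 h2 h2
    · exact h
    · have := mul_pos hs (sub_pos.mpr (not_le.mp h2)); linarith
    · linarith
    · linarith
  · intro r
    by_cases h : r ≤ c
    · simp [h]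
    · have h1 : ¬ (c + s⁻¹ * (r - c) ≤ c) := by
        have := mul_pos (inv_pos.mpr hs) (sub_pos.mpr (not_le.mp h)); linarith
      simp only [h, if_false, h1]
      field_simp
      ring

theorem TL {α β x y : ℚ} (h1 : α < x) (h2 : x < β) (h3 : α < y) (h4 : y < β) :
    ∃ f : Qa, f x = y ∧ (∀ r, r ≤ α → f r = r) ∧ (∀ r, β ≤ r → f r = r) := by
  have e1 : 0 < x - α := by linarith
  have e2 : 0 < y - α := by linarith
  have e3 : 0 < β - x := by linarith
  have e4 : 0 < β - y := by linarith
  have p1 : 0 < (y - α) / (x - α) := by positivity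
  have p2 : 0 < ((β - y) / (β - x)) * ((x - α) / (y - α)) := by positivity
  have p3 : 0 < (β - x) / (β - y) := by positivity
  obtain ⟨f1, hf1⟩ := kink_ex α _ p1
  obtain ⟨f2, hf2⟩ := kink_ex y _ p2
  obtain ⟨f3, hf3⟩ := kink_ex β _ p3
  have hx : f1 x = y := by
    rw [hf1, if_neg (by linarith)]; field_simp; ring
  refine ⟨f3 * (f2 * f1), ?_, ?_, ?_⟩
  · rw [RelIso.mul_apply, RelIso.mul_apply, hx, hf2, if_pos (le_refl _), hf3, if_pos h4.le]
  · intro r hr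
    rw [RelIso.mul_apply, RelIso.mul_apply, hf1, if_pos hr, hf2, if_pos (by linarith), hf3,
      if_pos (by linarith)]
  · intro r hr
    have k1 : y < f1 r := by rw [← hx]; exact f1.strictMono (by linarith)
    have k2 : f2 (f1 r) = y + ((β - y) / (β - x)) * (r - x) := by
      rw [hf2, if_neg (not_le.mpr k1), hf1, if_neg (by linarith)]
      field_simp; ring
    have k3 : f2 (f1 r) = β + ((β - y) / (β - x)) * (r - β) := by
      rw [k2]; field_simp; ring
    rw [RelIso.mul_apply, RelIso.mul_apply, hf3, k3]
    rcases hr.eq_or_lt with rfl | hr'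
    · simp
    · rw [if_neg]
      · field_simp; ring
      · have : 0 < ((β - y) / (β - x)) * (r - β) := mul_pos (by positivity) (by linarith)
        linarith

/-- Same as `TL` but for any countable dense order without endpoints. -/
theorem TL' {X : Type} [LinearOrder X] [Countable X] [DenselyOrdered X] [NoMinOrder X]
    [NoMaxOrder X] [Nonempty X] {α β x y : X} (h1 : α < x) (h2 : x < β) (h3 : α < y) (h4 : y < β) :
    ∃ f : X ≃o X, f x = y ∧ (∀ r, r ≤ α → f r = r) ∧ (∀ r, β ≤ r → f r = r) := by
  obtain ⟨e⟩ := Order.iso_of_countable_dense X ℚ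
  obtain ⟨f, a, b, c⟩ := TL (e.strictMono h1) (e.strictMono h2) (e.strictMono h3) (e.strictMono h4)
  refine ⟨(e.trans f).trans e.symm, ?_, ?_, ?_⟩
  · simp [a]
  · intro r hr; simp [b _ (e.monotone hr)]
  · intro r hr; simp [c _ (e.monotone hr)]

/-! ### germs -/

def Germ (f : Au) (u : T) (σ : Qa) : Prop :=
  ∃ a0 : ℚ, ∀ a ≤ a0, ∀ w, f (u ++ a :: w) = f u ++ σ a :: w

def D : Subgroup Au where
  carrier := {f | ∀ u, Germ f u 1}
  one_mem' := fun u => ⟨0, fun a _ w => rfl⟩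
  mul_mem' := by
    intro f g hf hg u
    obtain ⟨a0, h0⟩ := hg u
    obtain ⟨a1, h1⟩ := hf (g u)
    refine ⟨min a0 a1, fun a ha w => ?_⟩
    rw [RelIso.mul_apply, h0 a (le_trans ha (min_le_left _ _))]
    exact h1 a (le_trans ha (min_le_right _ _)) w
  inv_mem' := by
    intro f hf u
    obtain ⟨a0, h0⟩ := hf (f⁻¹ u)
    refine ⟨a0, fun a ha w => ?_⟩
    apply inv_apply_of
    rw [show (f⁻¹ u ++ (1 : Qa) a :: w) = f⁻¹ u ++ a :: w from rfl, h0 a ha]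
    simp

theorem germ_lift_cons (m : Qa) (r : ℚ) (u : T) : Germ (lift m) (r :: u) 1 :=
  ⟨0, fun _ _ _ => rfl⟩

theorem germ_lift_nil (m : Qa) : Germ (lift m) [] m :=
  ⟨0, fun _ _ _ => rfl⟩

theorem lift_mem_D {m : Qa} {c : ℚ} (h : ∀ r ≤ c, m r = r) : lift m ∈ D := by
  rintro (_ | ⟨r, u⟩)
  · exact ⟨c, fun a ha w => by simp [h a ha, app_nil]⟩
  · exact germ_lift_cons m r u

theorem germ_fib {β : ℚ → Au} {r : ℚ} {u : T} {σ : Qa} (h : Germ (β r) u σ) :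
    Germ (fib β) (r :: u) σ := by
  obtain ⟨a0, h0⟩ := h
  exact ⟨a0, fun a ha w => by simp [h0 a ha]⟩

theorem fib_germ_nil {β : ℚ → Au} {c : ℚ} (h : ∀ r ≤ c, β r = 1) : Germ (fib β) [] 1 :=
  ⟨c, fun a ha w => by simp [h a ha, app_nil]⟩

noncomputable def at1 (a : ℚ) : Au →* Au := fib.comp (MonoidHom.mulSingle (fun _ : ℚ => Au) a)

theorem at1_same (a : ℚ) (g : Au) (w : T) : at1 a g (a :: w) = a :: g w := by
  simp [at1]

theorem at1_other {a r : ℚ} (h : r ≠ a) (g : Au) (w : T) : at1 a g (r :: w) = r :: w := by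
  simp [at1, h]

theorem at1_mem_D {a : ℚ} {g : Au} (hg : g ∈ D) : at1 a g ∈ D := by
  rintro (_ | ⟨r, u⟩)
  · exact fib_germ_nil (c := a - 1) fun r hr => by
      have : r ≠ a := by rintro rfl; linarith
      simp [this]
  · apply germ_fib
    by_cases h : r = a
    · subst h; simpa using hg u
    · simpa [h] using (one_mem D : (1 : Au) ∈ D) u

theorem at1_mem_InH (a : ℚ) (g : Au) : at1 a g ∈ InH {a} := fun r v hr => at1_other hr g v

theorem lift_mem_InH {m : Qa} {I : Set ℚ} (h : ∀ r ∉ I, m r = r) : lift m ∈ InH I :=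
  fun r v hr => by simp [h r hr]

end FL


namespace FL

theorem encIso {X : Type} [LinearOrder X] (enc : X → T → T)
    (h1 : ∀ x w y w', enc x w < enc y w' ↔ x < y ∨ x = y ∧ w < w')
    (h2 : ∀ l, (∃ x w, l = enc x w) ∨ ∀ x w, l < enc x w) (ψ : X ≃o X) :
    ∃ B : Au, (∀ x w, B (enc x w) = enc (ψ x) w) ∧ (∀ l, (∀ x w, l ≠ enc x w) → B l = l) := by
  have hinj : ∀ x w y w', enc x w = enc y w' → x = y ∧ w = w' := by
    intro x w y w' h
    have a1 := (h1 x w y w').not.mp (by rw [h]; exact lt_irrefl _)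
    have a2 := (h1 y w' x w).not.mp (by rw [h]; exact lt_irrefl _)
    push Not at a1 a2
    have hx : x = y := le_antisymm a2.1 a1.1
    exact ⟨hx, le_antisymm (a2.2 hx.symm) (a1.2 hx)⟩
  have key : ∀ φ : X ≃o X, ∃ f : T → T, (∀ x w, f (enc x w) = enc (φ x) w) ∧
      (∀ l, (∀ x w, l ≠ enc x w) → f l = l) := by
    intro φ
    have : ∀ l : T, ∃ l' : T, (∀ x w, l = enc x w → l' = enc (φ x) w) ∧
        ((∀ x w, l ≠ enc x w) → l' = l) := by
      intro l
      by_cases h : ∃ x w, l = enc x w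
      · obtain ⟨x, w, rfl⟩ := h
        refine ⟨enc (φ x) w, ?_, fun h => absurd rfl (h x w)⟩
        intro y w' h
        obtain ⟨rfl, rfl⟩ := hinj _ _ _ _ h
        rfl
      · push Not at h
        exact ⟨l, fun x w h' => absurd h' (h x w), fun _ => rfl⟩
    choose f hf using this
    exact ⟨f, fun x w => (hf _).1 x w rfl, fun l h => (hf l).2 h⟩
  obtain ⟨f, f1, f2⟩ := key ψ
  obtain ⟨g, g1, g2⟩ := key ψ.symm
  have hm : StrictMono f := by
    intro l l' h
    rcases h2 l with ⟨x, w, rfl⟩ | hl <;> rcases h2 l' with ⟨y, w', rfl⟩ | hl'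
    · rw [f1, f1, h1]
      rcases (h1 _ _ _ _).mp h with h' | ⟨rfl, h'⟩
      · exact Or.inl (ψ.strictMono h')
      · exact Or.inr ⟨rfl, h'⟩
    · exact absurd (h.trans (hl' x w)) (lt_irrefl _)
    · rw [f2 l (fun x w => (hl x w).ne), f1]; exact hl _ _
    · rw [f2 l (fun x w => (hl x w).ne), f2 l' (fun x w => (hl' x w).ne)]; exact h
  obtain ⟨B, hB⟩ := mk_iso f g hm (by
    intro l
    rcases h2 l with ⟨x, w, rfl⟩ | hl
    · rw [g1, f1]; simp
    · rw [g2 l (fun x w => (hl x w).ne), f2 l (fun x w => (hl x w).ne)])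
  exact ⟨B, fun x w => by rw [hB, f1], fun l h => by rw [hB, f2 l h]⟩

def encX (c : ℚ) (x : ℚ ⊕ₗ (Set.Ioi c)) (w : T) : T :=
  match ofLex x with
  | Sum.inl b => c :: b :: w
  | Sum.inr r => r.1 :: w

theorem BL {c d e : ℚ} (hcd : c < d) (hde : d < e) :
    ∃ B : Au, B ∈ D ∧ B ∈ InH (Set.Ico c e) ∧ (∀ w, B (d :: w) = c :: 0 :: w) ∧
      ∀ r w, c < r → r ≤ d → ∃ v, B (r :: w) = c :: v := by
  have hce : c < e := hcd.trans hde
  have hl : ∀ b w, encX c (Sum.inlₗ b) w = c :: b :: w := fun _ _ => rfl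
  have hr : ∀ r w, encX c (Sum.inrₗ r) w = r.1 :: w := fun _ _ => rfl
  have hcase : ∀ x : ℚ ⊕ₗ (Set.Ioi c), (∃ b, x = Sum.inlₗ b) ∨ ∃ r, x = Sum.inrₗ r := by
    intro x
    rcases h : ofLex x with b | r
    · exact Or.inl ⟨b, h⟩
    · exact Or.inr ⟨r, h⟩
  have : Countable (ℚ ⊕ₗ (Set.Ioi c)) := inferInstanceAs (Countable (ℚ ⊕ (Set.Ioi c)))
  obtain ⟨ψ, q1, q2, q3⟩ := TL' (X := ℚ ⊕ₗ (Set.Ioi c)) (α := Sum.inlₗ (-1)) (β := Sum.inrₗ ⟨e, hce⟩)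
    (x := Sum.inrₗ ⟨d, hcd⟩) (y := Sum.inlₗ 0) (Sum.Lex.inl_lt_inr _ _)
    (Sum.Lex.inr_lt_inr_iff.mpr hde)
    (Sum.Lex.inl_lt_inl_iff.mpr (by norm_num)) (Sum.Lex.inl_lt_inr _ _)
  obtain ⟨B, b1, b2⟩ := encIso (encX c) (by
      intro x w y w'
      rcases hcase x with ⟨b, rfl⟩ | ⟨r, rfl⟩ <;> rcases hcase y with ⟨b', rfl⟩ | ⟨r', rfl⟩
      · simp only [hl, cons_lt, Sum.Lex.inl_lt_inl_iff]
        simp [Sum.inlₗ]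
      · simp only [hl, hr, cons_lt]
        simp [Sum.Lex.inl_lt_inr, r'.2.out]
      · simp only [hl, hr, cons_lt]
        simp [Sum.Lex.not_inr_lt_inl, r.2.out.not_gt, r.2.out.ne']
      · simp only [hr, cons_lt, Sum.Lex.inr_lt_inr_iff]
        simp [Sum.inrₗ, Subtype.ext_iff]) (by
      intro l
      have hlow : ∀ l : T, l ≤ [c] → ∀ x w, l < encX c x w := by
        intro l h x w
        refine lt_of_le_of_lt h ?_
        rcases hcase x with ⟨b, rfl⟩ | ⟨r, rfl⟩
        · rw [hl, cons_lt]; exact Or.inr ⟨rfl, List.nil_lt_cons _ _⟩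
        · rw [hr, cons_lt]; exact Or.inl r.2
      rcases l with _ | ⟨r, v⟩
      · exact Or.inr (hlow _ (nil_le _))
      · rcases lt_trichotomy r c with h | rfl | h
        · exact Or.inr (hlow _ (cons_le.mpr (Or.inl h)))
        · rcases v with _ | ⟨b, v⟩
          · exact Or.inr (hlow _ (le_refl _))
          · exact Or.inl ⟨Sum.inlₗ b, v, rfl⟩
        · exact Or.inl ⟨Sum.inrₗ ⟨r, h⟩, v, rfl⟩) ψ
  have hlow : ∀ r v, r < c → B (r :: v) = r :: v := by
    intro r v h
    apply b2
    intro x w h'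
    rcases hcase x with ⟨b, rfl⟩ | ⟨r', rfl⟩
    · rw [hl] at h'; simp at h'; exact h.ne h'.1
    · rw [hr] at h'; simp at h'; exact absurd (h'.1 ▸ r'.2.out) h.not_gt
  have hc0 : B [c] = [c] := by
    apply b2
    intro x w h'
    rcases hcase x with ⟨b, rfl⟩ | ⟨r', rfl⟩
    · rw [hl] at h'; simp at h'
    · rw [hr] at h'; simp at h'; exact absurd r'.2.out (by rw [← h'.1]; exact lt_irrefl _)
  have happ : ∀ x w w', encX c x (w ++ w') = encX c x w ++ w' := by
    intro x w w'
    rcases hcase x with ⟨b, rfl⟩ | ⟨r', rfl⟩ <;> rfl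
  have henc : ∀ x v, Germ B (encX c x v) 1 := by
    intro x v
    refine ⟨0, fun a _ w => ?_⟩
    rw [← happ, b1, b1, happ]; rfl
  refine ⟨B, ?_, ?_, ?_, ?_⟩
  · rintro (_ | ⟨r, v⟩)
    · refine ⟨c - 1, fun a ha w => ?_⟩
      rw [app_nil]
      exact hlow _ _ (by linarith)
    · rcases lt_trichotomy r c with h | rfl | h
      · exact ⟨0, fun a _ w => by
          rw [List.cons_append, hlow _ _ h, hlow _ _ h]; rfl⟩
      · rcases v with _ | ⟨b, v⟩
        · refine ⟨-1, fun a ha w => ?_⟩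
          rw [hc0]
          have := b1 (Sum.inlₗ a) w
          rw [q2 _ (Sum.Lex.inl_le_inl_iff.mpr ha), hl] at this
          exact this
        · exact henc (Sum.inlₗ b) v
      · exact henc (Sum.inrₗ ⟨r, h⟩) v
  · intro r v h
    rw [Set.mem_Ico, not_and_or, not_le, not_lt] at h
    rcases h with h | h
    · exact hlow r v h
    · have hcr : c < r := by linarith
      have := b1 (Sum.inrₗ ⟨r, hcr⟩) v
      rw [q3 _ (Sum.Lex.inr_le_inr_iff.mpr h), hr] at this
      exact this
  · intro w
    have := b1 (Sum.inrₗ ⟨d, hcd⟩) w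
    rwa [q1, hl, hr] at this
  · intro r w h1 h2
    have := b1 (Sum.inrₗ ⟨r, h1⟩) w
    have hle : ψ (Sum.inrₗ ⟨r, h1⟩) ≤ ψ (Sum.inrₗ ⟨d, hcd⟩) :=
      ψ.monotone (Sum.Lex.inr_le_inr_iff.mpr h2)
    rw [q1] at hle
    rcases hcase (ψ (Sum.inrₗ ⟨r, h1⟩)) with ⟨b, hb⟩ | ⟨r', hb⟩
    · rw [hb, hl] at this
      exact ⟨_, this⟩
    · rw [hb] at hle
      exact absurd hle (Sum.Lex.not_inr_le_inl)

theorem TLD {α β x y : ℚ} (h1 : α < x) (h2 : x < β) (h3 : α < y) (h4 : y < β) :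
    ∃ f : Qa, f x = y ∧ lift f ∈ D ∧ lift f ∈ InH (Set.Ioo α β) := by
  obtain ⟨f, a, b, d⟩ := TL h1 h2 h3 h4
  refine ⟨f, a, lift_mem_D b, lift_mem_InH ?_⟩
  intro r hr
  rw [Set.mem_Ioo, not_and_or, not_lt, not_lt] at hr
  exact hr.elim (b r) (d r)

theorem mover (u' : T) : ∀ (b α β c : ℚ), α < c → c < β → α < b → b < β →
    ∃ f : Au, f ∈ D ∧ f ∈ InH (Set.Ioo α β) ∧ ∀ w, f (c :: w) = b :: u' ++ w := by
  induction u' with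
  | nil =>
    intro b α β c h1 h2 h3 h4
    obtain ⟨f, a, hD, hI⟩ := TLD h1 h2 h3 h4
    exact ⟨lift f, hD, hI, fun w => by simp [a]⟩
  | cons b' u'' ih =>
    intro b α β c h1 h2 h3 h4
    obtain ⟨c1, k1, k2⟩ := exists_between (h1.trans h2)
    obtain ⟨d1, k3, k4⟩ := exists_between k2
    obtain ⟨e1, k5, k6⟩ := exists_between k4
    obtain ⟨f1, a1, D1, I1⟩ := TLD h1 h2 (k1.trans k3) k4
    obtain ⟨B, DB, IB, hB, -⟩ := BL k3 k5
    obtain ⟨f2, a2, D2, I2⟩ := TLD k1 k2 h3 h4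
    obtain ⟨f', D', -, h'⟩ := ih b' (min 0 b' - 1) (max 0 b' + 1) 0
      (by linarith [min_le_left 0 b']) (by linarith [le_max_left 0 b'])
      (by linarith [min_le_right 0 b']) (by linarith [le_max_right 0 b'])
    refine ⟨at1 b f' * (lift f2 * (B * lift f1)), ?_, ?_, ?_⟩
    · exact mul_mem (at1_mem_D D') (mul_mem D2 (mul_mem DB D1))
    · refine mul_mem (InH.mono ?_ (at1_mem_InH b f')) (mul_mem I2 (mul_mem (InH.mono ?_ IB) I1))
      · rintro _ rfl; exact ⟨h3, h4⟩
      · intro r hr; exact ⟨k1.trans_le hr.1, hr.2.trans k6⟩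
    · intro w
      simp only [RelIso.mul_apply, lift_cons, a1, hB, a2, at1_same, h']
      rfl

end FL


namespace FL

def nn (r : ℚ) : ℤ := ⌊r / 8⌋

theorem nn_le (r : ℚ) : 8 * (nn r : ℚ) ≤ r := by
  have := Int.floor_le (r / 8); unfold nn; linarith

theorem lt_nn (r : ℚ) : r < 8 * (nn r : ℚ) + 8 := by
  have := Int.lt_floor_add_one (r / 8); unfold nn; linarith

theorem nn_unique {r : ℚ} {n : ℤ} (h1 : 8 * (n : ℚ) ≤ r) (h2 : r < 8 * (n : ℚ) + 8) : nn r = n := by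
  unfold nn
  rw [Int.floor_eq_iff]
  constructor <;> linarith

theorem nn_add (r : ℚ) (n : ℤ) : nn (r + 8 * n) = nn r + n := by
  apply nn_unique
  · push_cast; linarith [nn_le r]
  · push_cast; linarith [lt_nn r]

theorem nn_mono {r s : ℚ} (h : r ≤ s) : nn r ≤ nn s :=
  Int.floor_le_floor (by linarith)

abbrev Blk : Subgroup Au := InH (Set.Ico 0 8)

noncomputable def perFun (w : Au) : T → T
  | [] => []
  | r :: v => sh (8 * nn r) (w ((r - 8 * nn r) :: v))

theorem perFun_spec {w : Au} (hw : w ∈ Blk) (r : ℚ) (v : T) :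
    ∃ ρ v', 0 ≤ ρ ∧ ρ < 8 ∧ w ((r - 8 * nn r) :: v) = ρ :: v' ∧
      perFun w (r :: v) = (ρ + 8 * nn r) :: v' := by
  obtain ⟨ρ, h, v', h'⟩ := InH.app hw (r := r - 8 * nn r)
    ⟨by linarith [nn_le r], by linarith [lt_nn r]⟩ v
  exact ⟨ρ, v', h.1, h.2, h', by rw [perFun, h', sh_cons]⟩

theorem perFun_mono {w : Au} (hw : w ∈ Blk) : StrictMono (perFun w) := by
  rintro (_ | ⟨a, l⟩) (_ | ⟨b, l'⟩) h
  · exact absurd h (lt_irrefl _)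
  · obtain ⟨ρ, v', -, -, -, h'⟩ := perFun_spec hw b l'
    rw [h']
    exact List.nil_lt_cons _ _
  · exact absurd h (not_lt.mpr (nil_le _))
  · have hab : a ≤ b := by
      rcases cons_lt.mp h with h | h
      · exact h.le
      · exact h.1.le
    rcases (nn_mono hab).eq_or_lt with e | e
    · rw [perFun, perFun, e]
      apply (sh _).strictMono
      apply w.strictMono
      rw [cons_lt] at h ⊢
      simpa using h
    · obtain ⟨ρ, v', h1, h2, -, h'⟩ := perFun_spec hw a l
      obtain ⟨ρ1, v1', h3, h4, -, h1'⟩ := perFun_spec hw b l'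
      rw [h', h1', cons_lt]
      left
      have : (nn a : ℚ) + 1 ≤ nn b := by exact_mod_cast e
      linarith

theorem perFun_comp {w w' : Au} (hw' : w' ∈ Blk) (l : T) :
    perFun w (perFun w' l) = perFun (w * w') l := by
  rcases l with _ | ⟨r, v⟩
  · rfl
  · obtain ⟨ρ, v', h1, h2, h, h'⟩ := perFun_spec hw' r v
    rw [h', perFun, perFun, RelIso.mul_apply, h]
    have : nn (ρ + 8 * nn r) = nn r := nn_unique (by linarith) (by linarith)
    rw [this]
    congr 3
    ring

theorem perFun_one (l : T) : perFun 1 l = l := by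
  rcases l with _ | ⟨r, v⟩
  · rfl
  · simp [perFun]

open Classical in
noncomputable def per (w : Au) : Au :=
  if hw : w ∈ Blk then (perFun_mono hw).orderIsoOfRightInverse (perFun w) (perFun w⁻¹)
    (by intro l; rw [perFun_comp (inv_mem hw), mul_inv_cancel, perFun_one]) else 1

theorem per_apply {w : Au} (hw : w ∈ Blk) (l : T) : per w l = perFun w l := by
  unfold per
  rw [dif_pos hw]; rfl

theorem per_mul {w w' : Au} (hw : w ∈ Blk) (hw' : w' ∈ Blk) : per (w * w') = per w * per w' := by
  apply au_ext
  intro l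
  rw [RelIso.mul_apply, per_apply hw', per_apply hw, per_apply (mul_mem hw hw'), perFun_comp hw']

theorem per_one : per 1 = 1 := by
  apply au_ext
  intro l
  rw [per_apply (one_mem _), perFun_one]; rfl

theorem per_inv {w : Au} (hw : w ∈ Blk) : per w⁻¹ = (per w)⁻¹ := by
  rw [eq_inv_iff_mul_eq_one, ← per_mul (inv_mem hw) hw, inv_mul_cancel, per_one]

theorem per_base {w : Au} (hw : w ∈ Blk) {ρ : ℚ} (h0 : 0 ≤ ρ) (h1 : ρ < 8) (v : T) :
    per w (ρ :: v) = w (ρ :: v) := by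
  have : nn ρ = 0 := nn_unique (by simpa using h0) (by simpa using h1)
  rw [per_apply hw, perFun, this]
  simp [sh_zero]

theorem per_sh (w : Au) (n : ℤ) (l : T) :
    per w (sh (8 * n) l) = sh (8 * n) (per w l) := by
  by_cases hw : w ∈ Blk
  · rcases l with _ | ⟨r, v⟩
    · simp [app_nil]
    · rw [per_apply hw, per_apply hw, sh_cons, perFun, perFun, nn_add,
        show (8 : ℚ) * ((nn r + n : ℤ) : ℚ) = 8 * n + 8 * nn r by push_cast; ring, sh_add,
        RelIso.mul_apply]
      congr 4; ring
  · unfold per; rw [dif_neg hw]; rfl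

/-- decomposition of nonempty points -/
theorem decomp (r : ℚ) (v : T) : ∃ ρ : ℚ, 0 ≤ ρ ∧ ρ < 8 ∧ ρ = r - 8 * nn r ∧
    r :: v = sh (8 * nn r) (ρ :: v) :=
  ⟨r - 8 * nn r, by linarith [nn_le r], by linarith [lt_nn r], rfl, by simp⟩

/-- two maps commuting with the shift by 8 that agree on the fundamental block are equal -/
theorem ext_per {f g : Au} (hf : ∀ (n : ℤ) l, f (sh (8 * n) l) = sh (8 * n) (f l))
    (hg : ∀ (n : ℤ) l, g (sh (8 * n) l) = sh (8 * n) (g l))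
    (h : ∀ ρ v, 0 ≤ ρ → ρ < 8 → f (ρ :: v) = g (ρ :: v)) : f = g := by
  apply ext_cons
  intro r v
  obtain ⟨ρ, h0, h1, -, e⟩ := decomp r v
  rw [e, hf, hg, h ρ v h0 h1]

theorem comm_of {f : Au} (h : f * sh 8 = sh 8 * f) (n : ℤ) (l : T) :
    f (sh (8 * n) l) = sh (8 * n) (f l) := by
  have : Commute f (sh 8) := h
  have := (this.zpow_right n).eq
  rw [← sh_int] at this
  exact DFunLike.congr_fun this l

theorem mem_block (r : ℚ) (v : T) : [0] ≤ r :: v ∧ r :: v < [8] ↔ 0 ≤ r ∧ r < 8 := by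
  rw [cons_le, cons_lt]
  have := nil_le v
  have h2 : ¬ (v < []) := not_lt.mpr this
  simp [this, h2, le_iff_lt_or_eq]

theorem extract {f : Au} (hc : ∀ (n : ℤ) l, f (sh (8 * n) l) = sh (8 * n) (f l))
    (hf : ∀ ρ v, 0 ≤ ρ → ρ < 8 → ρ ∉ Set.Ico (1 : ℚ) 7 → f (ρ :: v) = ρ :: v) :
    ∃ w0 : Au, w0 ∈ InH (Set.Ico 1 7) ∧ per w0 = f ∧ ((∀ u ≠ [], Germ f u 1) → w0 ∈ D) := by
  classical
  have f0 : f [0] = [0] := hf 0 [] (by norm_num) (by norm_num) (by norm_num)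
  have f8 : f [8] = [8] := by
    have := hc 1 [0]
    rw [f0] at this
    simpa using this
  have pres : ∀ l, ([0] ≤ f l ∧ f l < [8]) ↔ ([0] ≤ l ∧ l < [8]) := by
    intro l
    conv_lhs => rw [← f0, ← f8]
    rw [f.le_iff_le, f.lt_iff_lt]
  have pres' : ∀ l, ([0] ≤ f⁻¹ l ∧ f⁻¹ l < [8]) ↔ ([0] ≤ l ∧ l < [8]) := by
    intro l
    rw [← pres]; simp
  obtain ⟨w0, hw0⟩ := mk_iso (fun l : T => if [0] ≤ l ∧ l < [8] then f l else l)
    (fun l : T => if [0] ≤ l ∧ l < [8] then f⁻¹ l else l) (by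
      intro l l' h
      beta_reduce
      split_ifs with h1 h2 h2
      · exact f.strictMono h
      · have := (pres l).mpr h1
        by_contra h3
        rw [not_lt] at h3
        exact h2 ⟨h1.1.trans h.le, h3.trans_lt this.2⟩
      · have := (pres l').mpr h2
        by_contra h3
        rw [not_lt] at h3
        exact h1 ⟨this.1.trans h3, h.trans h2.2⟩
      · exact h) (by
      intro l
      by_cases h : [0] ≤ l ∧ l < [8]
      · simp only [h, and_self, if_true, (pres' l).mpr h]; simp
      · simp only [h, if_false])
  have hin : ∀ ρ v, 0 ≤ ρ → ρ < 8 → w0 (ρ :: v) = f (ρ :: v) := by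
    intro ρ v h0 h8
    rw [hw0, if_pos ((mem_block ρ v).mpr ⟨h0, h8⟩)]
  have hout : ∀ ρ v, ¬ (0 ≤ ρ ∧ ρ < 8) → w0 (ρ :: v) = ρ :: v := by
    intro ρ v h
    rw [hw0, if_neg]
    rwa [mem_block]
  have hI : w0 ∈ InH (Set.Ico 1 7) := by
    intro r v hr
    by_cases h : 0 ≤ r ∧ r < 8
    · rw [hin r v h.1 h.2]; exact hf r v h.1 h.2 hr
    · exact hout r v h
  have hB : w0 ∈ Blk := InH.mono (Set.Ico_subset_Ico (by norm_num) (by norm_num)) hI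
  refine ⟨w0, hI, ?_, ?_⟩
  · apply ext_per (per_sh w0) hc
    intro ρ v h0 h8
    rw [per_base hB h0 h8, hin _ _ h0 h8]
  · intro hg u
    rcases u with _ | ⟨r, v⟩
    · exact ⟨-1, fun a ha w => by
        rw [app_nil]
        exact hout _ _ (by intro h; linarith [h.1])⟩
    · by_cases h : 0 ≤ r ∧ r < 8
      · obtain ⟨a0, h0⟩ := hg (r :: v) (by simp)
        exact ⟨a0, fun a ha w => by
          rw [List.cons_append, hin _ _ h.1 h.2, hin _ _ h.1 h.2]; exact h0 a ha w⟩
      · exact ⟨0, fun a ha w => by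
          rw [List.cons_append, hout _ _ h, hout _ _ h]; rfl⟩

/-! ### good maps -/

def GG (f : Au) (u : T) (σ : Qa) : Prop :=
  ∃ (e : ℕ) (a0 : ℚ), ∀ (n : ℤ), ∀ a ≤ a0, ∀ w,
    f (sh (8 * 4 ^ e * n) (u ++ a :: w)) = sh (8 * 4 ^ e * n) (f u ++ σ a :: w)

theorem GG.up {f : Au} {u : T} {σ : Qa} (h : GG f u σ) : ∃ e0 : ℕ, ∃ a0 : ℚ, ∀ e ≥ e0,
    ∀ (n : ℤ), ∀ a ≤ a0, ∀ w,
    f (sh (8 * 4 ^ e * n) (u ++ a :: w)) = sh (8 * 4 ^ e * n) (f u ++ σ a :: w) := by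
  obtain ⟨e0, a0, h⟩ := h
  refine ⟨e0, a0, fun e he n a ha w => ?_⟩
  have := h (4 ^ (e - e0) * n) a ha w
  have e1 : (8 * 4 ^ e0 * ((4 ^ (e - e0) * n : ℤ) : ℚ)) = 8 * 4 ^ e * n := by
    push_cast
    rw [← mul_assoc, mul_assoc 8, ← pow_add, Nat.add_sub_cancel' he]
  rwa [e1] at this

theorem GG.germ {f : Au} {u : T} {σ : Qa} (h : GG f u σ) : Germ f u σ := by
  obtain ⟨e, a0, h⟩ := h
  refine ⟨a0, fun a ha w => ?_⟩
  have := h 0 a ha w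
  simpa [sh_zero] using this

theorem GG.mul {f g : Au} {u : T} {σ τ : Qa} (hg : GG g u σ) (hf : GG f (g u) τ) :
    GG (f * g) u (τ * σ) := by
  obtain ⟨e0, a0, h0⟩ := hg.up
  obtain ⟨e1, a1, h1⟩ := hf.up
  refine ⟨max e0 e1, min a0 (σ⁻¹ a1), fun n a ha w => ?_⟩
  rw [RelIso.mul_apply, h0 _ (le_max_left _ _) n a (ha.trans (min_le_left _ _)),
    h1 _ (le_max_right _ _) n (σ a) ?_]
  · rfl
  · have := σ.monotone (ha.trans (min_le_right _ _))
    simpa using this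

theorem GG.inv {f : Au} {u : T} {σ : Qa} (hf : GG f (f⁻¹ u) σ) : GG f⁻¹ u σ⁻¹ := by
  obtain ⟨e, a0, h⟩ := hf
  refine ⟨e, σ a0, fun n a ha w => ?_⟩
  apply inv_apply_of
  rw [h]
  · simp
  · have := (σ⁻¹).monotone ha
    simpa using this

def Good (A : Set Qa) (f : Au) : Prop := ∀ u ≠ [], ∃ σ ∈ A, GG f u σ

open Pointwise in
theorem Good.mul {A B : Set Qa} {f g : Au} (hf : Good A f) (hg : Good B g) :
    Good (A * B) (f * g) := by
  intro u hu
  obtain ⟨σ, h1, h2⟩ := hg u hu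
  obtain ⟨τ, h3, h4⟩ := hf (g u) (app_ne_nil g hu)
  exact ⟨τ * σ, Set.mul_mem_mul h3 h1, h2.mul h4⟩

open Pointwise in
theorem Good.inv {A : Set Qa} {f : Au} (hf : Good A f) : Good A⁻¹ f⁻¹ := by
  intro u hu
  obtain ⟨σ, h1, h2⟩ := hf (f⁻¹ u) (app_ne_nil _ hu)
  exact ⟨σ⁻¹, Set.inv_mem_inv.mpr h1, h2.inv⟩

theorem Good.mono {A B : Set Qa} (h : A ⊆ B) {f : Au} (hf : Good A f) : Good B f := by
  intro u hu
  obtain ⟨σ, h1, h2⟩ := hf u hu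
  exact ⟨σ, h h1, h2⟩

theorem GG_of_comm {f : Au} (hc : ∀ (n : ℤ) l, f (sh (8 * n) l) = sh (8 * n) (f l))
    {u : T} {σ : Qa} (h : Germ f u σ) : GG f u σ := by
  obtain ⟨a0, h⟩ := h
  refine ⟨0, a0, fun n a ha w => ?_⟩
  rw [show (8 * 4 ^ 0 * (n : ℚ)) = 8 * n by ring, hc, h a ha]

theorem germ_per {w : Au} (hw : w ∈ Blk) {r : ℚ} {u : T} {σ : Qa}
    (h : Germ w ((r - 8 * nn r) :: u) σ) : Germ (per w) (r :: u) σ := by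
  obtain ⟨a0, h⟩ := h
  refine ⟨a0, fun a ha v => ?_⟩
  obtain ⟨ρ, h0, h8, rfl, -⟩ := decomp r u
  rw [per_apply hw, per_apply hw, List.cons_append, perFun, perFun, ← List.cons_append, h a ha,
    sh_append]
  exact app_ne_nil _ (by simp)

theorem good_per {w : Au} (hw : w ∈ Blk) (hD : w ∈ D) : Good {1} (per w) := by
  rintro (_ | ⟨r, u⟩) hu
  · exact absurd rfl hu
  · exact ⟨1, rfl, GG_of_comm (per_sh w) (germ_per hw (hD _))⟩

theorem good_sh (d : ℚ) : Good {1} (sh d) := by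
  rintro (_ | ⟨r, u⟩) hu
  · exact absurd rfl hu
  · refine ⟨1, rfl, GG_of_comm ?_ (germ_lift_cons _ r u)⟩
    intro n l
    exact DFunLike.congr_fun (sh_comm d (8 * n)) l

def Str (A : Set Qa) (f : Au) : Prop := ∀ u, ∃ σ ∈ A, Germ f u σ

theorem good_fib {A : Set Qa} {β : ℚ → Au} (h1 : ∀ r, Str A (β r))
    (h2 : ∀ r, ∃ e : ℕ, ∀ n : ℤ, β (r + 8 * 4 ^ e * n) = β r) : Good A (fib β) := by
  rintro (_ | ⟨r, u⟩) hu
  · exact absurd rfl hu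
  · obtain ⟨σ, hσ, a0, h⟩ := h1 r u
    obtain ⟨e, he⟩ := h2 r
    refine ⟨σ, hσ, e, a0, fun n a ha w => ?_⟩
    rw [List.cons_append, sh_cons, fib_cons, fib_cons, he, h a ha, List.cons_append, sh_cons]

theorem str_of_D {A : Set Qa} (hA : 1 ∈ A) {f : Au} (hf : f ∈ D) : Str A f :=
  fun u => ⟨1, hA, hf u⟩

end FL


namespace FL
open scoped commutatorElement

/-! ### labels -/

theorem lab_ex (n : ℤ) : ∃ (l : ℕ) (y : ℤ), 3 * n + 1 = 4 ^ l * y ∧ ¬ (4 ∣ y) := by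
  have hfin : FiniteMultiplicity (4 : ℤ) (3 * n + 1) := by
    rw [Int.finiteMultiplicity_iff]
    constructor
    · decide
    · omega
  obtain ⟨y, h1, h2⟩ := hfin.exists_eq_pow_mul_and_not_dvd
  exact ⟨_, y, h1, h2⟩

noncomputable def lv (n : ℤ) : ℕ := (lab_ex n).choose
noncomputable def yv (n : ℤ) : ℤ := (lab_ex n).choose_spec.choose

theorem lab_spec (n : ℤ) : 3 * n + 1 = 4 ^ lv n * yv n ∧ ¬ (4 ∣ yv n) :=
  (lab_ex n).choose_spec.choose_spec

theorem four_pow_unique {l l' : ℕ} {y y' : ℤ} (h : 4 ^ l * y = 4 ^ l' * y') (hy : ¬ (4 ∣ y))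
    (hy' : ¬ (4 ∣ y')) : l = l' ∧ y = y' := by
  have aux : ∀ {l l' : ℕ} {y y' : ℤ}, 4 ^ l * y = 4 ^ l' * y' → ¬ (4 ∣ y) → l' ≤ l := by
    intro l l' y y' h hy
    by_contra hl
    rw [not_le] at hl
    obtain ⟨k, rfl⟩ := Nat.exists_eq_add_of_lt hl
    have : y = 4 ^ (k + 1) * y' := by
      have h4 : (4 : ℤ) ^ l ≠ 0 := by positivity
      apply mul_left_cancel₀ h4
      rw [h]; ring
    exact hy ⟨4 ^ k * y', by rw [this]; ring⟩
  have e : l = l' := le_antisymm (aux h.symm hy') (aux h hy)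
  subst e
  exact ⟨rfl, mul_left_cancel₀ (by positivity) h⟩

theorem lab_unique {n : ℤ} {l : ℕ} {y : ℤ} (h : 3 * n + 1 = 4 ^ l * y) (hy : ¬ (4 ∣ y)) :
    lv n = l ∧ yv n = y :=
  four_pow_unique ((lab_spec n).1.symm.trans h) (lab_spec n).2 hy

theorem lab_per (n k : ℤ) : lv (n + 4 ^ (lv n + 1) * k) = lv n ∧
    yv (n + 4 ^ (lv n + 1) * k) % 4 = yv n % 4 := by
  obtain ⟨h1, h2⟩ := lab_spec n
  have := lab_unique (n := n + 4 ^ (lv n + 1) * k) (l := lv n) (y := yv n + 12 * k)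
    (by linear_combination h1) (by omega)
  refine ⟨this.1, ?_⟩
  rw [this.2]; omega

theorem lab_B {n : ℤ} (h : yv n % 4 = 2) (j : ℕ) : yv (n + 4 ^ j) % 4 = 1 ↔ lv n = j := by
  obtain ⟨h1, h2⟩ := lab_spec n
  obtain ⟨s, hs⟩ : ∃ s, yv n = 4 * s + 2 := ⟨yv n / 4, by omega⟩
  rcases lt_trichotomy (lv n) j with hl | hl | hl
  · obtain ⟨k, rfl⟩ := Nat.exists_eq_add_of_lt hl
    have := lab_unique (n := n + 4 ^ (lv n + k + 1)) (l := lv n) (y := 4 * (s + 3 * 4 ^ k) + 2)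
      (by linear_combination h1 + 4 ^ lv n * hs) (by omega)
    rw [this.2]
    omega
  · have := lab_unique (n := n + 4 ^ j) (l := lv n) (y := 4 * (s + 1) + 1)
      (by rw [← hl]; linear_combination h1 + 4 ^ lv n * hs) (by omega)
    rw [this.2]
    omega
  · obtain ⟨k, hk⟩ := Nat.exists_eq_add_of_lt hl
    have := lab_unique (n := n + 4 ^ j) (l := j) (y := 4 * (4 ^ k * (4 * s + 2)) + 3)
      (by rw [hk] at h1; linear_combination h1 + 4 ^ (j + k + 1) * hs) (by omega)
    rw [this.2]
    omega

theorem nj_ex (j : ℕ) : ∃ n : ℤ, 3 * n + 1 = 10 * 4 ^ j := by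
  induction j with
  | zero => exact ⟨3, by norm_num⟩
  | succ j ih =>
    obtain ⟨n, hn⟩ := ih
    exact ⟨4 * n + 1, by rw [pow_succ]; linear_combination 4 * hn⟩

theorem class_iff {j : ℕ} {nj : ℤ} (hj : 3 * nj + 1 = 10 * 4 ^ j) (n : ℤ) :
    (yv n % 4 = 2 ∧ lv n = j) ↔ ∃ k, n = nj + 4 ^ (j + 1) * k := by
  constructor
  · rintro ⟨h, rfl⟩
    obtain ⟨h1, h2⟩ := lab_spec n
    obtain ⟨s, hs⟩ : ∃ s, yv n = 4 * s + 2 := ⟨yv n / 4, by omega⟩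
    have h3 : 3 * (n - nj) = 4 ^ (lv n + 1) * (s - 2) := by
      linear_combination h1 - hj + 4 ^ lv n * hs
    have h4 : (4 : ℤ) ^ (lv n + 1) ∣ n - nj := by
      have : IsCoprime ((4 : ℤ) ^ (lv n + 1)) 3 := IsCoprime.pow_left ⟨1, -1, by norm_num⟩
      exact this.dvd_of_dvd_mul_left ⟨_, h3⟩
    obtain ⟨k, hk⟩ := h4
    exact ⟨k, by linarith⟩
  · rintro ⟨k, rfl⟩
    have := lab_unique (n := nj + 4 ^ (j + 1) * k) (l := j) (y := 4 * (3 * k + 2) + 2)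
      (by linear_combination hj) (by omega)
    refine ⟨?_, this.1⟩
    rw [this.2]; omega

/-! ### t and plus -/

theorem tt_ex : ∃ m : Qa, (∀ r ≤ -1, m r = r) ∧ (∀ r, 0 ≤ r → m r = r + 1) := by
  obtain ⟨f, hf⟩ := kink_ex (-1) 2 (by norm_num)
  obtain ⟨g, hg⟩ := kink_ex 1 (1 / 2) (by norm_num)
  refine ⟨g * f, fun r hr => ?_, fun r hr => ?_⟩
  · rw [RelIso.mul_apply, hf, if_pos hr, hg, if_pos (by linarith)]
  · rw [RelIso.mul_apply, hf, if_neg (by linarith), hg]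
    rcases hr.eq_or_lt with rfl | h
    · norm_num
    · rw [if_neg (by linarith)]; ring

noncomputable def tt : Qa := tt_ex.choose
theorem tt_low {r : ℚ} (h : r ≤ -1) : tt r = r := tt_ex.choose_spec.1 r h
theorem tt_high {r : ℚ} (h : 0 ≤ r) : tt r = r + 1 := tt_ex.choose_spec.2 r h

noncomputable def t : Au := lift tt

theorem t_mem_D : t ∈ D := lift_mem_D (c := -1) fun _ h => tt_low h

open Classical in
noncomputable def indHom (P : ℚ → Prop) : Au →* Au where
  toFun g := fib (fun r => if P r then g else 1)
  map_one' := by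
    have : (fun r => if P r then (1 : Au) else 1) = 1 := by
      funext r; split_ifs <;> rfl
    rw [this, map_one]
  map_mul' g h := by
    rw [← map_mul]
    congr 1
    funext r
    simp only [Pi.mul_apply]
    split_ifs <;> simp

theorem ind_cons {P : ℚ → Prop} {g : Au} {r : ℚ} (h : P r) (v : T) :
    indHom P g (r :: v) = r :: g v := by
  simp [indHom, h]

theorem ind_cons' {P : ℚ → Prop} {g : Au} {r : ℚ} (h : ¬ P r) (v : T) :
    indHom P g (r :: v) = r :: v := by
  simp [indHom, h]

theorem ind_ext {P Q : ℚ → Prop} (h : ∀ r, P r ↔ Q r) : indHom P = indHom Q := by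
  have : P = Q := funext fun r => propext (h r)
  rw [this]

theorem ind_conj (m : Qa) (P : ℚ → Prop) (g : Au) :
    lift m * indHom P g * (lift m)⁻¹ = indHom (fun r => P (m⁻¹ r)) g := lift_fib m _

theorem ind_sh (d : ℚ) (P : ℚ → Prop) (g : Au) :
    sh d * indHom P g * (sh d)⁻¹ = indHom (fun r => P (r - d)) g := sh_fib d _

theorem ind_comm (P Q : ℚ → Prop) (g h : Au) :
    ⁅indHom P g, indHom Q h⁆ = indHom (fun r => P r ∧ Q r) ⁅g, h⁆ := by
  change ⁅fib _, fib _⁆ = fib _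
  rw [← map_commutatorElement]
  congr 1
  funext r
  simp only [commutatorElement_def, Pi.mul_apply, Pi.inv_apply]
  by_cases h1 : P r <;> by_cases h2 : Q r <;> simp [h1, h2]

theorem ind_str {A : Set Qa} (h1 : 1 ∈ A) {P : ℚ → Prop} {c : ℚ} (hP : ∀ r, P r → c ≤ r) {g : Au}
    (hg : Str A g) : Str A (indHom P g) := by
  classical
  rintro (_ | ⟨r, u⟩)
  · refine ⟨1, h1, fib_germ_nil (c := c - 1) fun r hr => ?_⟩
    rw [if_neg]
    intro h
    linarith [hP r h]
  · by_cases h : P r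
    · obtain ⟨σ, hσ, h'⟩ := hg u
      exact ⟨σ, hσ, germ_fib (by simpa [h] using h')⟩
    · exact ⟨1, h1, germ_fib (by simpa [h] using (one_mem D : (1 : Au) ∈ D) u)⟩

theorem at1_eq (a : ℚ) : at1 a = indHom (fun r => r = a) := by
  apply MonoidHom.ext
  intro g
  apply ext_cons
  intro r v
  by_cases h : r = a
  · subst h; rw [at1_same, ind_cons (P := fun x => x = r) rfl]
  · rw [at1_other h, ind_cons' (P := fun x => x = a) h]

noncomputable def plus : Au →* Au := indHom (fun r => ∃ k : ℕ, r = k)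

theorem plus_t (g : Au) : ⁅plus g, t⁆ = at1 0 g := by
  have h1 : t * plus g * t⁻¹ = indHom (fun r => ∃ k : ℕ, r = k + 1) g := by
    rw [t, plus, ind_conj]
    congr 1
    apply ind_ext
    intro r
    constructor
    · rintro ⟨k, hk⟩
      refine ⟨k, ?_⟩
      rw [← tt_high (Nat.cast_nonneg k), ← hk]; simp
    · rintro ⟨k, hk⟩
      exact ⟨k, inv_apply_of (by rw [tt_high (Nat.cast_nonneg k), hk])⟩
  have h2 : ⁅plus g, t⁆ = plus g * (t * plus g * t⁻¹)⁻¹ := by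
    rw [commutatorElement_def]; group
  rw [h2, h1, mul_inv_eq_iff_eq_mul]
  apply ext_cons
  intro r v
  rw [RelIso.mul_apply]
  by_cases hr : ∃ k : ℕ, r = k + 1
  · obtain ⟨k, hk⟩ := hr
    rw [ind_cons ⟨k, hk⟩, plus, ind_cons ⟨k + 1, by rw [hk]; push_cast; ring⟩, at1_other]
    rw [hk]; positivity
  · rw [ind_cons' hr]
    by_cases h0 : r = 0
    · subst h0; rw [plus, ind_cons ⟨0, by simp⟩, at1_same]
    · rw [at1_other h0, plus, ind_cons']
      rintro ⟨k, hk⟩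
      rcases k with _ | k
      · exact h0 (by simpa using hk)
      · exact hr ⟨k, by rw [hk]; push_cast; ring⟩

theorem plus_str {A : Set Qa} (h1 : 1 ∈ A) {g : Au} (hg : Str A g) : Str A (plus g) :=
  ind_str h1 (c := 0) (by rintro r ⟨k, rfl⟩; positivity) hg

/-! ### the generators -/

def ro (r : ℚ) : ℚ := r - 8 * nn r

theorem ro_add (r : ℚ) (n : ℤ) : ro (r + 8 * n) = ro r := by
  unfold ro; rw [nn_add]; push_cast; ring

noncomputable def Alab (G : ℕ → Au) (n : ℤ) : Au :=
  if yv n % 4 = 2 then plus (G (lv n)) else 1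

open Classical in
noncomputable def sa (G : ℕ → Au) : Au :=
  fib (fun r => if 4 ≤ ro r ∧ ro r < 5 then Alab G (nn r) else 1)

noncomputable def sb : Au :=
  indHom (fun r => (3 < ro r ∧ ro r ≤ 4) ∧ yv (nn r) % 4 = 1) t

theorem lab_per' (n k : ℤ) : ∀ r, nn r = n →
    lv (nn (r + 8 * 4 ^ (lv n + 1) * k)) = lv n ∧ yv (nn (r + 8 * 4 ^ (lv n + 1) * k)) % 4 = yv n % 4 := by
  rintro r rfl
  have : r + 8 * 4 ^ (lv (nn r) + 1) * k = r + 8 * ((4 ^ (lv (nn r) + 1) * k : ℤ) : ℚ) := by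
    push_cast; ring
  rw [this, nn_add]
  exact lab_per _ _

theorem ro_per (r : ℚ) (e : ℕ) (k : ℤ) : ro (r + 8 * 4 ^ e * k) = ro r := by
  have : r + 8 * 4 ^ e * k = r + 8 * ((4 ^ e * k : ℤ) : ℚ) := by
    push_cast; ring
  rw [this, ro_add]

theorem str_one {A : Set Qa} (h1 : 1 ∈ A) : Str A 1 := str_of_D h1 (one_mem _)

theorem good_sa {A : Set Qa} (h1 : 1 ∈ A) {G : ℕ → Au} (hG : ∀ n, Str A (G n)) : Good A (sa G) := by
  apply good_fib
  · intro r
    split_ifs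
    · unfold Alab
      split_ifs
      · exact plus_str h1 (hG _)
      · exact str_one h1
    · exact str_one h1
  · intro r
    refine ⟨lv (nn r) + 1, fun k => ?_⟩
    obtain ⟨a, b⟩ := lab_per' (nn r) k r rfl
    simp only [ro_per, Alab]
    rw [a, b]

theorem good_sb : Good {1} sb := by
  apply good_fib
  · intro r
    split_ifs
    · exact str_of_D (Set.mem_singleton _) t_mem_D
    · exact str_one (Set.mem_singleton _)
  · intro r
    refine ⟨lv (nn r) + 1, fun k => ?_⟩
    obtain ⟨a, b⟩ := lab_per' (nn r) k r rfl
    simp only [ro_per]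
    by_cases hc : (3 < ro r ∧ ro r ≤ 4) ∧ yv (nn r) % 4 = 1
    · rw [if_pos hc, if_pos ⟨hc.1, b.trans hc.2⟩]
    · rw [if_neg hc, if_neg (fun h => hc ⟨h.1, b.symm.trans h.2⟩)]

noncomputable def ga (e : ℕ) : Au →* Au :=
  (indHom (fun r => ∃ n : ℤ, r = 8 * 4 ^ e * n + 4)).comp (at1 0)

theorem ro_four {r : ℚ} : ro r = 4 ↔ ∃ n : ℤ, r = 8 * n + 4 := by
  constructor
  · intro h; exact ⟨nn r, by unfold ro at h; linarith⟩
  · rintro ⟨n, rfl⟩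
    rw [add_comm, ro_add]
    unfold ro
    rw [nn_unique (n := 0)] <;> norm_num

theorem comm_key (G : ℕ → Au) (j : ℕ) :
    ⁅sa G, sh (-(8 * 4 ^ j)) * sb * (sh (-(8 * 4 ^ j)))⁻¹⁆ =
      indHom (fun r => ro r = 4 ∧ yv (nn r) % 4 = 2 ∧ lv (nn r) = j) (at1 0 (G j)) := by
  classical
  rw [sb, ind_sh]
  change ⁅fib _, fib _⁆ = fib _
  rw [← map_commutatorElement]
  congr 1
  funext r
  have e1 : r - -(8 * 4 ^ j) = r + 8 * ((4 ^ j : ℤ) : ℚ) := by push_cast; ring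
  simp only [commutatorElement_def, Pi.mul_apply, Pi.inv_apply, e1, ro_add, nn_add]
  by_cases h4 : ro r = 4
  · simp only [h4]
    norm_num
    unfold Alab
    by_cases h2 : yv (nn r) % 4 = 2
    · simp only [h2, lab_B h2, if_true, true_and]
      by_cases hj : lv (nn r) = j
      · simp only [hj, if_true]
        rw [← commutatorElement_def, plus_t]
      · simp [hj]
    · simp only [h2, if_false, false_and, one_mul, inv_one, mul_one]
      split_ifs <;> simp
  · simp only [h4, false_and, if_false]
    by_cases h5 : 4 ≤ ro r ∧ ro r < 5
    · have h6 : ¬ ro r ≤ 4 := fun h => h4 (le_antisymm h h5.1)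
      simp only [h6, and_false, false_and, if_false, one_mul, inv_one, mul_one, mul_inv_cancel]
    · simp only [h5, if_false, one_mul, inv_one, mul_one, mul_inv_cancel]

theorem ga_mem {G : ℕ → Au} {H : Subgroup Au} (h1 : ∀ k : ℤ, sh (8 * k) ∈ H) (ha : sa G ∈ H)
    (hb : sb ∈ H) (j : ℕ) : ga (j + 1) (G j) ∈ H := by
  have hk := comm_key G j
  obtain ⟨nj, hj⟩ := nj_ex j
  have hs : sh (-(8 * 4 ^ j)) ∈ H := by
    have e : (-(8 * 4 ^ j) : ℚ) = 8 * ((-(4 ^ j) : ℤ) : ℚ) := by push_cast; ring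
    rw [e]
    exact h1 _
  have hm : indHom (fun r => ro r = 4 ∧ yv (nn r) % 4 = 2 ∧ lv (nn r) = j) (at1 0 (G j)) ∈ H := by
    rw [← hk, commutatorElement_def]
    have := mul_mem (mul_mem hs hb) (inv_mem hs)
    exact mul_mem (mul_mem (mul_mem ha this) (inv_mem ha)) (inv_mem this)
  have hs2 := h1 (-nj)
  have := mul_mem (mul_mem hs2 hm) (inv_mem hs2)
  rw [ind_sh] at this
  rw [ga, MonoidHom.comp_apply]
  rw [ind_ext] at this
  · exact this
  intro r
  have e1 : r - 8 * ((-nj : ℤ) : ℚ) = r + 8 * nj := by push_cast; ring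
  rw [e1, ro_add, nn_add, class_iff hj, ro_four]
  constructor
  · rintro ⟨⟨n, rfl⟩, k, hk⟩
    have : nn (8 * n + 4 : ℚ) = n := nn_unique (by linarith) (by linarith)
    rw [this] at hk
    refine ⟨k, ?_⟩
    have : n = 4 ^ (j + 1) * k := by linarith
    rw [this]; push_cast; ring
  · rintro ⟨k, rfl⟩
    refine ⟨⟨4 ^ (j + 1) * k, by push_cast; ring⟩, k, ?_⟩
    have : nn (8 * 4 ^ (j + 1) * k + 4 : ℚ) = 4 ^ (j + 1) * k :=
      nn_unique (by push_cast; linarith) (by push_cast; linarith)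
    rw [this]; ring

theorem ga_descent {K : Subgroup Au} (h1 : ∀ k : ℤ, ∀ x ∈ K, sh (8 * k) * x * (sh (8 * k))⁻¹ ∈ K)
    {e : ℕ} {g : Au} (h : ga (e + 1) g ∈ K) : ga e g ∈ K := by
  have hi : ∀ i : ℤ, indHom (fun r => ∃ n : ℤ, r - 8 * 4 ^ e * i = 8 * 4 ^ (e + 1) * n + 4) (at1 0 g) ∈ K := by
    intro i
    have := h1 (4 ^ e * i) _ h
    have e : (8 * ((4 ^ e * i : ℤ) : ℚ)) = 8 * 4 ^ e * i := by push_cast; ring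
    rw [ga, MonoidHom.comp_apply, ind_sh, e] at this
    exact this
  have hprod := mul_mem (hi 0) (mul_mem (hi 1) (mul_mem (hi 2) (hi 3)))
  convert hprod using 1
  have h4 : (4 : ℚ) ^ e ≠ 0 := by positivity
  have hcond : ∀ (r : ℚ) (i : ℤ), (∃ n : ℤ, r - 8 * 4 ^ e * i = 8 * 4 ^ (e + 1) * n + 4) ↔
      ∃ n : ℤ, r = 8 * 4 ^ e * n + 4 ∧ ∃ m, n = 4 * m + i := by
    intro r i
    constructor
    · rintro ⟨n, hn⟩
      exact ⟨4 * n + i, by rw [pow_succ] at hn; push_cast; linear_combination hn, n, rfl⟩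
    · rintro ⟨n, hn, m, rfl⟩
      exact ⟨m, by rw [hn, pow_succ]; push_cast; ring⟩
  apply ext_cons
  intro r v
  rw [ga, MonoidHom.comp_apply]
  simp only [RelIso.mul_apply]
  by_cases hr : ∃ n : ℤ, r = 8 * 4 ^ e * n + 4
  · obtain ⟨n, hn⟩ := hr
    rw [ind_cons ⟨n, hn⟩]
    have hiff : ∀ i : ℤ, (∃ n : ℤ, r - 8 * 4 ^ e * i = 8 * 4 ^ (e + 1) * n + 4) ↔ (n - i) % 4 = 0 := by
      intro i
      rw [hcond]
      constructor
      · rintro ⟨n', hn', m, hm⟩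
        have : (n : ℚ) = n' := by
          rw [hn] at hn'
          have : 8 * 4 ^ e * ((n : ℚ) - n') = 0 := by linear_combination hn'
          have := (mul_eq_zero.mp this).resolve_left (by positivity)
          linarith
        have : n = n' := by exact_mod_cast this
        omega
      · intro h
        exact ⟨n, hn, (n - i) / 4, by omega⟩
    have hval : ∀ i : ℤ, ∀ w, (n - i) % 4 = 0 → indHom (fun r => ∃ n : ℤ, r - 8 * 4 ^ e * i = 8 * 4 ^ (e + 1) * n + 4) (at1 0 g) (r :: w) = r :: at1 0 g w :=
      fun i w h => ind_cons ((hiff i).mpr h) w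
    have hval' : ∀ i : ℤ, ∀ w, (n - i) % 4 ≠ 0 → indHom (fun r => ∃ n : ℤ, r - 8 * 4 ^ e * i = 8 * 4 ^ (e + 1) * n + 4) (at1 0 g) (r :: w) = r :: w :=
      fun i w h => ind_cons' (fun h' => h ((hiff i).mp h')) w
    have : n % 4 = 0 ∨ n % 4 = 1 ∨ n % 4 = 2 ∨ n % 4 = 3 := by omega
    rcases this with h | h | h | h
    · rw [hval' 3 _ (by omega), hval' 2 _ (by omega), hval' 1 _ (by omega), hval 0 _ (by omega)]
    · rw [hval' 3 _ (by omega), hval' 2 _ (by omega), hval 1 _ (by omega), hval' 0 _ (by omega)]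
    · rw [hval' 3 _ (by omega), hval 2 _ (by omega), hval' 1 _ (by omega), hval' 0 _ (by omega)]
    · rw [hval 3 _ (by omega), hval' 2 _ (by omega), hval' 1 _ (by omega), hval' 0 _ (by omega)]
  · rw [ind_cons' hr]
    have hv : ∀ i : ℤ, ∀ w, indHom (fun r => ∃ n : ℤ, r - 8 * 4 ^ e * i = 8 * 4 ^ (e + 1) * n + 4) (at1 0 g) (r :: w) = r :: w := by
      intro i w
      apply ind_cons'
      rw [hcond]
      rintro ⟨n, hn, -⟩
      exact hr ⟨n, hn⟩
    rw [hv, hv, hv, hv]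

theorem ga_down {K : Subgroup Au} (h1 : ∀ k : ℤ, ∀ x ∈ K, sh (8 * k) * x * (sh (8 * k))⁻¹ ∈ K)
    {e e' : ℕ} (he : e' ≤ e) {g : Au} (h : ga e g ∈ K) : ga e' g ∈ K := by
  induction e, he using Nat.le_induction with
  | base => exact h
  | succ n _ ih => exact ih (ga_descent h1 h)

end FL


namespace FL
open scoped commutatorElement

abbrev I7 : Set ℚ := Set.Ico 1 7

theorem blk_of {J : Set ℚ} (h : J ⊆ Set.Ico 0 8) {y : Au} (hy : y ∈ InH J) : y ∈ Blk := InH.mono h hy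

theorem I7_sub : I7 ⊆ Set.Ico 0 8 := Set.Ico_subset_Ico (by norm_num) (by norm_num)

theorem del_ex : ∃ δ : Au, δ ∈ D ∧ δ ∈ InH (Set.Ico (1 / 2) (15 / 2)) ∧
    ∀ r ∈ I7, ∀ w, ∃ v, δ (r :: w) = 4 :: 0 :: 0 :: v := by
  obtain ⟨B, B1, B2, -, B4⟩ := BL (c := 3 / 4) (d := 7) (e := 15 / 2) (by norm_num) (by norm_num)
  obtain ⟨M, M1, M2, M3⟩ := mover [0, 0] 4 (1 / 2) (15 / 2) (3 / 4) (by norm_num) (by norm_num)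
    (by norm_num) (by norm_num)
  refine ⟨M * B, mul_mem M1 B1, mul_mem (InH.mono ?_ M2) (InH.mono ?_ B2), ?_⟩
  · exact Set.Ioo_subset_Ico_self
  · exact Set.Ico_subset_Ico (by norm_num) (by norm_num)
  · intro r hr w
    obtain ⟨v, hv⟩ := B4 r w (by linarith [hr.1]) hr.2.le
    exact ⟨v, by rw [RelIso.mul_apply, hv, M3]; rfl⟩

noncomputable def del : Au := del_ex.choose
theorem del_D : del ∈ D := del_ex.choose_spec.1
theorem del_InH : del ∈ InH (Set.Ico (1 / 2) (15 / 2)) := del_ex.choose_spec.2.1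
theorem del_spec : ∀ r ∈ I7, ∀ w, ∃ v, del (r :: w) = 4 :: 0 :: 0 :: v := del_ex.choose_spec.2.2
theorem del_Blk : del ∈ Blk :=
  blk_of (Set.Ico_subset_Ico (by norm_num) (by norm_num)) del_InH

theorem compress {y : Au} (hD : y ∈ D) (hy : y ∈ InH I7) :
    ∃ g ∈ D, del * y * del⁻¹ = at1 4 (at1 0 (at1 0 g)) := by
  have key : ∀ y ∈ InH I7, ∀ l, (del * y * del⁻¹) l ≠ l → ∃ v, l = 4 :: 0 :: 0 :: v := by
    intro y hy l hl
    simp only [RelIso.mul_apply] at hl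
    rcases h : del⁻¹ l with _ | ⟨r, w⟩
    · rw [h, app_nil] at hl
      rw [← h] at hl; simp at hl
    · by_cases hr : r ∈ I7
      · obtain ⟨v, hv⟩ := del_spec r hr w
        rw [← h] at hv
        exact ⟨v, by rw [← hv]; simp⟩
      · rw [h, hy r w hr, ← h] at hl; simp at hl
  have key2 : ∀ y ∈ InH I7, ∀ v, ∃ v', (del * y * del⁻¹) (4 :: 0 :: 0 :: v) = 4 :: 0 :: 0 :: v' := by
    intro y hy v
    by_cases h : (del * y * del⁻¹) (4 :: 0 :: 0 :: v) = 4 :: 0 :: 0 :: v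
    · exact ⟨v, h⟩
    · exact key y hy _ (fun h' => h ((del * y * del⁻¹).injective h'))
  choose g1 h1 using key2 y hy
  choose g2 h2 using key2 y⁻¹ (inv_mem hy)
  have hi : (del * y⁻¹ * del⁻¹) = (del * y * del⁻¹)⁻¹ := by group
  rw [hi] at h2
  have hfD : del * y * del⁻¹ ∈ D := mul_mem (mul_mem del_D hD) (inv_mem del_D)
  have hout := key y hy
  generalize del * y * del⁻¹ = f at *
  obtain ⟨g, hg⟩ := mk_iso g1 g2 (by
      intro v v' h
      have : f (4 :: 0 :: 0 :: v) < f (4 :: 0 :: 0 :: v') := f.strictMono (by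
        simp only [cons_lt, h, lt_irrefl, true_and, and_self, or_true])
      rw [h1, h1] at this
      simpa only [cons_lt, lt_irrefl, true_and, false_or] using this) (by
      intro v
      have := h1 (g2 v)
      rw [← h2] at this
      simpa using this.symm)
  refine ⟨g, ?_, ?_⟩
  · intro u
    obtain ⟨a0, h0⟩ := hfD (4 :: 0 :: 0 :: u)
    refine ⟨a0, fun a ha w => ?_⟩
    have := h0 a ha w
    simp only [List.cons_append, h1] at this
    rw [hg, hg]
    simpa using this
  · apply au_ext
    intro l
    by_cases hl : ∃ v, l = 4 :: 0 :: 0 :: v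
    · obtain ⟨v, rfl⟩ := hl
      rw [h1, at1_same, at1_same, at1_same, hg]
    · have e1 : f l = l := by
        by_contra h
        exact hl (hout l h)
      rw [e1]
      rcases l with _ | ⟨a, _ | ⟨b, _ | ⟨c, v⟩⟩⟩
      · rw [app_nil]
      · by_cases ha : a = 4
        · subst ha; rw [at1_same, app_nil]
        · rw [at1_other ha]
      · by_cases ha : a = 4
        · subst ha; rw [at1_same]
          by_cases hb : b = 0
          · subst hb; rw [at1_same, app_nil]
          · rw [at1_other hb]
        · rw [at1_other ha]
      · by_cases ha : a = 4
        · subst ha; rw [at1_same]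
          by_cases hb : b = 0
          · subst hb; rw [at1_same]
            by_cases hc : c = 0
            · subst hc; exact absurd ⟨v, rfl⟩ hl
            · rw [at1_other hc]
          · rw [at1_other hb]
        · rw [at1_other ha]

theorem ga_cons (e : ℕ) (g : Au) (n : ℤ) (v : T) :
    ga e g ((8 * 4 ^ e * (n : ℚ) + 4) :: v) = (8 * 4 ^ e * (n : ℚ) + 4) :: at1 0 g v := by
  rw [ga, MonoidHom.comp_apply, ind_cons ⟨n, rfl⟩]

theorem ga_cons' {e : ℕ} {g : Au} {r : ℚ} (h : ¬ ∃ n : ℤ, r = 8 * 4 ^ e * n + 4) (v : T) :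
    ga e g (r :: v) = r :: v := by
  rw [ga, MonoidHom.comp_apply, ind_cons' h]

theorem ga0_comm (g : Au) (n : ℤ) (l : T) : ga 0 g (sh (8 * n) l) = sh (8 * n) (ga 0 g l) := by
  rcases l with _ | ⟨r, v⟩
  · simp [app_nil]
  · by_cases h : ∃ k : ℤ, r = 8 * 4 ^ 0 * k + 4
    · obtain ⟨k, rfl⟩ := h
      rw [ga_cons, sh_cons, sh_cons]
      have e : (8 * 4 ^ 0 * (k : ℚ) + 4 + 8 * n) = 8 * 4 ^ 0 * ((k + n : ℤ) : ℚ) + 4 := by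
        push_cast; ring
      rw [e, ga_cons]
    · rw [ga_cons' h, sh_cons, ga_cons']
      rintro ⟨k, hk⟩
      exact h ⟨k - n, by push_cast; linear_combination hk⟩

theorem per_at (g : Au) : per (at1 4 (at1 0 g)) = ga 0 g := by
  have hB : at1 4 (at1 0 g) ∈ Blk := blk_of (by rintro _ rfl; norm_num) (at1_mem_InH _ _)
  apply ext_per (per_sh _) (ga0_comm g)
  intro ρ v h0 h8
  rw [per_base hB h0 h8]
  by_cases h : ρ = 4
  · subst h
    rw [at1_same]
    have := ga_cons 0 g 0 v
    simpa using this.symm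
  · rw [at1_other h, ga_cons']
    rintro ⟨n, hn⟩
    have h1 : (-1 : ℚ) < n := by linarith
    have h2 : (n : ℚ) < 1 := by linarith
    have h3 : -1 < n := by exact_mod_cast h1
    have h4 : n < 1 := by exact_mod_cast h2
    have : n = 0 := by omega
    subst this
    exact h (by simpa using hn)

/-- g-part attached to y -/
theorem compress_per {y : Au} (hD : y ∈ D) (hy : y ∈ InH I7) :
    ∃ g ∈ D, per del * per y * (per del)⁻¹ = ⁅ga 0 (plus g), ga 0 t⁆ := by
  obtain ⟨g, hg, h⟩ := compress hD hy
  refine ⟨g, hg, ?_⟩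
  have hyB := blk_of I7_sub hy
  rw [← per_inv del_Blk, ← per_mul del_Blk hyB, ← per_mul (mul_mem del_Blk hyB) (inv_mem del_Blk),
    h, per_at, ← map_commutatorElement, plus_t]

/-! ### absorption -/

theorem per_lift_ex (m : Qa) (hm : lift m ∈ Blk) :
    ∃ M : Qa, lift M = per (lift m) ∧ ∀ n : ℤ, ∀ ρ, 0 ≤ ρ → ρ < 8 → M (ρ + 8 * n) = m ρ + 8 * n := by
  have hval : ∀ r, per (lift m) [r] = [m (r - 8 * nn r) + 8 * nn r] := by
    intro r
    rw [per_apply hm]; rfl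
  have hval' : ∀ r, per (lift m⁻¹) [r] = [m⁻¹ (r - 8 * nn r) + 8 * nn r] := by
    intro r
    rw [per_apply (by rw [map_inv]; exact inv_mem hm)]; rfl
  obtain ⟨M, hM⟩ := mk_iso (fun r => m (r - 8 * nn r) + 8 * nn r)
    (fun r => m⁻¹ (r - 8 * nn r) + 8 * nn r) (by
      intro r s h
      have : per (lift m) [r] < per (lift m) [s] := (per (lift m)).strictMono (cons_lt.mpr (Or.inl h))
      rw [hval, hval, cons_lt] at this
      simpa using this) (by
      intro r
      have h1 := hval (m⁻¹ (r - 8 * nn r) + 8 * nn r)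
      rw [← hval' r, map_inv, per_inv hm] at h1
      simpa using h1.symm)
  refine ⟨M, ?_, ?_⟩
  · apply ext_cons
    intro r v
    rw [lift_cons, hM, per_apply hm]; rfl
  · intro n ρ h0 h8
    have : nn (ρ + 8 * n) = n := nn_unique (by linarith) (by linarith)
    rw [hM, this]
    congr 2; ring

theorem absorb (C : Set ℚ) (A : ℤ → Au) (β : ℚ → Au)
    (hβ : ∀ (n : ℤ) ρ, 0 ≤ ρ → ρ < 8 → (ρ ∈ C → β (ρ + 8 * n) = A n) ∧ (ρ ∉ C → β (ρ + 8 * n) = 1))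
    (q p : Qa) (hq : lift q ∈ Blk) (hp : lift p ∈ Blk)
    (h1 : ∀ ρ ∈ C, q⁻¹ ρ ∈ C ∧ p⁻¹ ρ ∉ C) (h2 : ∀ ρ, ρ ∉ C → (q⁻¹ ρ ∈ C ↔ p⁻¹ ρ ∈ C)) :
    per (lift q) * fib β * (per (lift q))⁻¹ =
      fib β * (per (lift p) * fib β * (per (lift p))⁻¹) := by
  obtain ⟨Q, hQ, hQ'⟩ := per_lift_ex q hq
  obtain ⟨P, hP, hP'⟩ := per_lift_ex p hp
  have inv_form : ∀ (m M : Qa), lift m ∈ Blk →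
      (∀ n : ℤ, ∀ ρ, 0 ≤ ρ → ρ < 8 → M (ρ + 8 * n) = m ρ + 8 * n) →
      ∀ n : ℤ, ∀ ρ, 0 ≤ ρ → ρ < 8 → M⁻¹ (ρ + 8 * n) = m⁻¹ ρ + 8 * n ∧ 0 ≤ m⁻¹ ρ ∧ m⁻¹ ρ < 8 := by
    intro m M hm hM n ρ h0 h8
    have hb : 0 ≤ m⁻¹ ρ ∧ m⁻¹ ρ < 8 := by
      have hmi : lift m⁻¹ ∈ Blk := by rw [map_inv]; exact inv_mem hm
      obtain ⟨r', hr', v', h⟩ := InH.app hmi (r := ρ) ⟨h0, h8⟩ []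
      rw [lift_cons] at h
      simp only [List.cons.injEq] at h
      rw [h.1]; exact hr'
    refine ⟨inv_apply_of ?_, hb⟩
    rw [hM _ _ hb.1 hb.2]; simp
  rw [← hQ, ← hP, lift_fib, lift_fib, ← map_mul]
  congr 1
  funext r
  obtain ⟨ρ, n, h0, h8, rfl⟩ : ∃ (ρ : ℚ) (n : ℤ), 0 ≤ ρ ∧ ρ < 8 ∧ r = ρ + 8 * n :=
    ⟨r - 8 * nn r, nn r, by linarith [nn_le r], by linarith [lt_nn r], by ring⟩
  simp only [Pi.mul_apply]
  obtain ⟨a1, a2, a3⟩ := inv_form q Q hq hQ' n ρ h0 h8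
  obtain ⟨b1, b2, b3⟩ := inv_form p P hp hP' n ρ h0 h8
  rw [a1, b1]
  by_cases hc : ρ ∈ C
  · rw [(hβ n _ a2 a3).1 (h1 ρ hc).1, (hβ n _ b2 b3).2 (h1 ρ hc).2, (hβ n _ h0 h8).1 hc, mul_one]
  · rw [(hβ n _ h0 h8).2 hc, one_mul]
    by_cases hc' : q⁻¹ ρ ∈ C
    · rw [(hβ n _ a2 a3).1 hc', (hβ n _ b2 b3).1 ((h2 ρ hc).mp hc')]
    · rw [(hβ n _ a2 a3).2 hc', (hβ n _ b2 b3).2 (fun h => hc' ((h2 ρ hc).mpr h))]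

theorem absorb_mem {K : Subgroup Au} {q p s : Au} (h : q * s * q⁻¹ = s * (p * s * p⁻¹))
    (hq : q ∈ K) (hp : p ∈ K) (hs : s⁻¹ * q * s ∈ K) : s ∈ K := by
  have : s = p⁻¹ * (s⁻¹ * q * s * q⁻¹) * p := by
    have h' : s⁻¹ * (q * s * q⁻¹) = p * s * p⁻¹ := by rw [h]; group
    calc s = p⁻¹ * (p * s * p⁻¹) * p := by group
      _ = _ := by rw [← h']; group
  rw [this]
  exact mul_mem (mul_mem (inv_mem hp) (mul_mem hs (inv_mem hq))) hp

theorem q_ex : ∃ q p : Qa, (lift q ∈ D ∧ lift q ∈ InH I7) ∧ (lift p ∈ D ∧ lift p ∈ InH I7) ∧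
    q 4 = 4 ∧ q 5 = 6 ∧ p 4 = 5 ∧ p 5 = 6 := by
  obtain ⟨q, a, b, c⟩ := TLD (α := 4) (β := 7) (x := 5) (y := 6) (by norm_num) (by norm_num)
    (by norm_num) (by norm_num)
  obtain ⟨q', a', b', c'⟩ := TLD (α := 3) (β := 6) (x := 4) (y := 5) (by norm_num) (by norm_num)
    (by norm_num) (by norm_num)
  have q4 : q 4 = 4 := by
    have := c 4 [] (by norm_num)
    simpa using this
  have q6 : q' 6 = 6 := by
    have := c' 6 [] (by norm_num)
    simpa using this
  have s1 : Set.Ioo (4 : ℚ) 7 ⊆ I7 := fun r hr => ⟨by linarith [hr.1], hr.2⟩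
  have s2 : Set.Ioo (3 : ℚ) 6 ⊆ I7 := fun r hr => ⟨by linarith [hr.1], by linarith [hr.2]⟩
  refine ⟨q, q' * q, ⟨b, InH.mono s1 c⟩, ⟨?_, ?_⟩, q4, a, ?_, ?_⟩
  · rw [map_mul]; exact mul_mem b' b
  · rw [map_mul]; exact mul_mem (InH.mono s2 c') (InH.mono s1 c)
  · rw [RelIso.mul_apply, q4, a']
  · rw [RelIso.mul_apply, a, q6]

theorem q'_ex : ∃ q p : Qa, (lift q ∈ D ∧ lift q ∈ InH I7) ∧ (lift p ∈ D ∧ lift p ∈ InH I7) ∧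
    q 4 = 4 ∧ q 3 = 2 ∧ p 4 = 3 ∧ p 3 = 2 := by
  obtain ⟨q, a, b, c⟩ := TLD (α := 1) (β := 4) (x := 3) (y := 2) (by norm_num) (by norm_num)
    (by norm_num) (by norm_num)
  obtain ⟨q', a', b', c'⟩ := TLD (α := 2) (β := 5) (x := 4) (y := 3) (by norm_num) (by norm_num)
    (by norm_num) (by norm_num)
  have q4 : q 4 = 4 := by
    have := c 4 [] (by norm_num)
    simpa using this
  have q2 : q' 2 = 2 := by
    have := c' 2 [] (by norm_num)
    simpa using this
  have s1 : Set.Ioo (1 : ℚ) 4 ⊆ I7 := fun r hr => ⟨by linarith [hr.1], by linarith [hr.2]⟩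
  have s2 : Set.Ioo (2 : ℚ) 5 ⊆ I7 := fun r hr => ⟨by linarith [hr.1], by linarith [hr.2]⟩
  refine ⟨q, q' * q, ⟨b, InH.mono s1 c⟩, ⟨?_, ?_⟩, q4, a, ?_, ?_⟩
  · rw [map_mul]; exact mul_mem b' b
  · rw [map_mul]; exact mul_mem (InH.mono s2 c') (InH.mono s1 c)
  · rw [RelIso.mul_apply, q4, a']
  · rw [RelIso.mul_apply, a, q2]

theorem inv_le {m : Qa} {a b : ℚ} (h : m a = b) (r : ℚ) : (a ≤ m⁻¹ r ↔ b ≤ r) ∧ (m⁻¹ r < a ↔ r < b) ∧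
    (a < m⁻¹ r ↔ b < r) ∧ (m⁻¹ r ≤ a ↔ r ≤ b) := by
  have h1 : a ≤ m⁻¹ r ↔ b ≤ r := by
    rw [← m.le_iff_le, h]; simp
  have h2 : m⁻¹ r ≤ a ↔ r ≤ b := by
    rw [← m.le_iff_le, h]; simp
  exact ⟨h1, by rw [← not_le, h1, not_le], by rw [← not_le, h2, not_le], h2⟩

theorem sa_absorb (G : ℕ → Au) {q p : Qa} (hq : lift q ∈ Blk) (hp : lift p ∈ Blk)
    (q4 : q 4 = 4) (q5 : q 5 = 6) (p4 : p 4 = 5) (p5 : p 5 = 6) :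
    per (lift q) * sa G * (per (lift q))⁻¹ = sa G * (per (lift p) * sa G * (per (lift p))⁻¹) := by
  apply absorb (Set.Ico 4 5) (Alab G) _ _ q p hq hp
  · intro ρ hρ
    simp only [Set.mem_Ico, (inv_le q4 ρ).1, (inv_le q5 ρ).2.1, (inv_le p4 ρ).1, (inv_le p5 ρ).2.1] at *
    constructor
    · constructor <;> linarith
    · intro h; linarith
  · intro ρ hρ
    simp only [Set.mem_Ico, (inv_le q4 ρ).1, (inv_le q5 ρ).2.1, (inv_le p4 ρ).1, (inv_le p5 ρ).2.1] at *
    constructor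
    · intro h
      exact ⟨by by_contra h'; exact hρ ⟨h.1, by linarith⟩, h.2⟩
    · intro h; exact ⟨by linarith, h.2⟩
  · intro n ρ h0 h8
    have e1 : nn (ρ + 8 * n) = n := nn_unique (by linarith) (by linarith)
    have e2 : ro (ρ + 8 * n) = ρ := by unfold ro; rw [e1]; ring
    rw [e1, e2]
    exact ⟨fun h => if_pos h, fun h => if_neg h⟩

theorem sb_absorb {q p : Qa} (hq : lift q ∈ Blk) (hp : lift p ∈ Blk)
    (q4 : q 4 = 4) (q5 : q 3 = 2) (p4 : p 4 = 3) (p5 : p 3 = 2) :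
    per (lift q) * sb * (per (lift q))⁻¹ = sb * (per (lift p) * sb * (per (lift p))⁻¹) := by
  apply absorb (Set.Ioc 3 4) (fun n => if yv n % 4 = 1 then t else 1) _ _ q p hq hp
  · intro ρ hρ
    simp only [Set.mem_Ioc, (inv_le q4 ρ).2.2.2, (inv_le q5 ρ).2.2.1, (inv_le p4 ρ).2.2.2,
      (inv_le p5 ρ).2.2.1] at *
    constructor
    · constructor <;> linarith
    · intro h; linarith
  · intro ρ hρ
    simp only [Set.mem_Ioc, (inv_le q4 ρ).2.2.2, (inv_le q5 ρ).2.2.1, (inv_le p4 ρ).2.2.2,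
      (inv_le p5 ρ).2.2.1] at *
    constructor
    · intro h
      exact ⟨h.1, by by_contra h'; exact hρ ⟨by linarith, h.2⟩⟩
    · intro h; exact ⟨h.1, by linarith⟩
  · intro n ρ h0 h8
    have e1 : nn (ρ + 8 * n) = n := nn_unique (by linarith) (by linarith)
    have e2 : ro (ρ + 8 * n) = ρ := by unfold ro; rw [e1]; ring
    constructor
    · intro h
      by_cases hy : yv n % 4 = 1
      · rw [if_pos hy, if_pos]
        beta_reduce; rw [e1, e2]; exact ⟨h, hy⟩
      · rw [if_neg hy, if_neg]
        beta_reduce; rw [e1, e2]; exact fun h' => hy h'.2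
    · intro h
      rw [if_neg]
      beta_reduce; rw [e1, e2]
      exact fun h' => h h'.1

end FL


namespace FL
open scoped commutatorElement

/-- Maps commuting with the shift by 8 and having trivial germs. -/
def GP : Subgroup Au where
  carrier := {f | (∀ (n : ℤ) l, f (sh (8 * n) l) = sh (8 * n) (f l)) ∧ ∀ u ≠ [], Germ f u 1}
  one_mem' := ⟨fun _ _ => rfl, fun u _ => (one_mem D : (1 : Au) ∈ D) u⟩
  mul_mem' := by
    rintro f g ⟨f1, f2⟩ ⟨g1, g2⟩
    refine ⟨fun n l => by rw [RelIso.mul_apply, g1, f1]; rfl, fun u hu => ?_⟩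
    exact ((GG_of_comm g1 (g2 u hu)).mul (GG_of_comm f1 (f2 _ (app_ne_nil g hu)))).germ
  inv_mem' := by
    rintro f ⟨f1, f2⟩
    refine ⟨fun n l => inv_apply_of (by rw [f1]; simp), fun u hu => ?_⟩
    have := (GG_of_comm f1 (f2 _ (app_ne_nil f⁻¹ hu))).inv.germ
    simpa using this

theorem sh_GP (d : ℚ) : sh d ∈ GP := by
  refine ⟨fun n l => DFunLike.congr_fun (sh_comm d (8 * n)) l, ?_⟩
  rintro (_ | ⟨r, u⟩) hu
  · exact absurd rfl hu
  · exact germ_lift_cons _ r u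

theorem per_GP {w : Au} (hw : w ∈ Blk) (hD : w ∈ D) : per w ∈ GP := by
  refine ⟨per_sh w, ?_⟩
  rintro (_ | ⟨r, u⟩) hu
  · exact absurd rfl hu
  · exact germ_per hw (hD _)

theorem extract_GP {f : Au} (hf : f ∈ GP) (h : ∀ r v, -1 ≤ r → r < 1 → f (r :: v) = r :: v) :
    ∃ w0 : Au, w0 ∈ D ∧ w0 ∈ InH I7 ∧ per w0 = f := by
  obtain ⟨w0, h1, h2, h3⟩ := extract hf.1 (by
    intro ρ v h0 h8 hρ
    rw [Set.mem_Ico, not_and_or, not_le, not_lt] at hρ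
    rcases hρ with h' | h'
    · exact h ρ v (by linarith) h'
    · have e : ρ :: v = sh (8 * ((1 : ℤ) : ℚ)) ((ρ - 8) :: v) := by simp
      rw [e, hf.1, h (ρ - 8) v (by linarith) (by linarith)])
  exact ⟨w0, h3 hf.2, h1, h2⟩

theorem xi_ex : ∃ m : Qa, (lift m ∈ D ∧ lift m ∈ InH I7) ∧ ∀ r, 2 ≤ r → r ≤ 4 → m r = r + 1 := by
  obtain ⟨k1, h1⟩ := kink_ex 1 2 (by norm_num)
  obtain ⟨k2, h2⟩ := kink_ex 3 (1 / 2) (by norm_num)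
  obtain ⟨k3, h3⟩ := kink_ex 5 (1 / 2) (by norm_num)
  obtain ⟨k4, h4⟩ := kink_ex 6 2 (by norm_num)
  have low : ∀ r ≤ 1, (k4 * (k3 * (k2 * k1))) r = r := by
    intro r hr
    simp only [RelIso.mul_apply]
    rw [h1, if_pos hr, h2, if_pos (by linarith), h3, if_pos (by linarith), h4, if_pos (by linarith)]
  have mid : ∀ r, 2 ≤ r → k2 (k1 r) = r + 1 := by
    intro r hr
    rw [h1, if_neg (by linarith), h2]
    split_ifs with h
    · linarith
    · ring
  refine ⟨k4 * (k3 * (k2 * k1)), ⟨lift_mem_D low, lift_mem_InH ?_⟩, ?_⟩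
  · intro r hr
    rw [Set.mem_Ico, not_and_or, not_le, not_lt] at hr
    rcases hr with hr | hr
    · exact low r hr.le
    · simp only [RelIso.mul_apply]
      rw [mid r (by linarith), h3, if_neg (by linarith), h4, if_neg (by linarith)]
      ring
  · intro r hr hr'
    simp only [RelIso.mul_apply]
    rw [mid r hr, h3, if_pos (by linarith), h4, if_pos (by linarith)]

theorem eta_ex : ∃ x y : Au, (x ∈ D ∧ x ∈ InH I7) ∧ (y ∈ D ∧ y ∈ InH I7) ∧
    sh 1 = (sh (-2) * per x * (sh (-2))⁻¹) * (sh 1 * per y * (sh 1)⁻¹) := by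
  obtain ⟨m, ⟨hD, hI⟩, hm⟩ := xi_ex
  have hB := blk_of I7_sub hI
  set X : Au := sh (-2) * per (lift m) * (sh (-2))⁻¹ with hX
  have hXG : X ∈ GP := mul_mem (mul_mem (sh_GP _) (per_GP hB hD)) (inv_mem (sh_GP _))
  obtain ⟨y, y1, y2, y3⟩ := extract_GP (f := (sh 1)⁻¹ * X⁻¹ * sh 2)
    (mul_mem (mul_mem (inv_mem (sh_GP _)) (inv_mem hXG)) (sh_GP _)) (by
      intro r v h1 h2
      have : X ((r + 1) :: v) = (r + 2) :: v := by
        rw [hX, ← sh_neg]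
        simp only [RelIso.mul_apply, sh_cons]
        rw [per_base hB (by linarith) (by linarith), lift_cons, hm _ (by linarith) (by linarith)]
        simp only [sh_cons]
        congr 1; ring
      simp only [RelIso.mul_apply, sh_cons]
      rw [inv_apply_of this]
      exact inv_apply_of (by simp))
  refine ⟨lift m, y, ⟨hD, hI⟩, ⟨y1, y2⟩, ?_⟩
  rw [y3, ← hX]
  have : (2 : ℚ) = 1 + 1 := by norm_num
  rw [this, sh_add]
  group

theorem delta_ex : ∃ x y : Au, (x ∈ D ∧ x ∈ InH I7) ∧ (y ∈ D ∧ y ∈ InH I7) ∧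
    (sh (-4) * per x * (sh (-4))⁻¹) * per del * (sh (-4) * per x * (sh (-4))⁻¹)⁻¹ = per y := by
  obtain ⟨m1, a1, b1, c1⟩ := TLD (α := 2) (β := 4) (x := 7 / 2) (y := 3) (by norm_num) (by norm_num)
    (by norm_num) (by norm_num)
  obtain ⟨m2, a2, b2, c2⟩ := TLD (α := 4) (β := 6) (x := 9 / 2) (y := 5) (by norm_num) (by norm_num)
    (by norm_num) (by norm_num)
  have s1 : Set.Ioo (2 : ℚ) 4 ⊆ I7 := fun r hr => ⟨by linarith [hr.1], by linarith [hr.2]⟩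
  have s2 : Set.Ioo (4 : ℚ) 6 ⊆ I7 := fun r hr => ⟨by linarith [hr.1], by linarith [hr.2]⟩
  have hD : lift (m1 * m2) ∈ D := by rw [map_mul]; exact mul_mem b1 b2
  have hI : lift (m1 * m2) ∈ InH I7 := by
    rw [map_mul]; exact mul_mem (InH.mono s1 c1) (InH.mono s2 c2)
  have e1 : (m1 * m2) (7 / 2) = 3 := by
    have := c2 (7 / 2) [] (by norm_num)
    simp only [lift_cons, List.cons.injEq] at this
    rw [RelIso.mul_apply, this.1, a1]
  have e2 : (m1 * m2) (9 / 2) = 5 := by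
    have := c1 5 [] (by norm_num)
    simp only [lift_cons, List.cons.injEq] at this
    rw [RelIso.mul_apply, a2, this.1]
  generalize m1 * m2 = m at *
  have hB := blk_of I7_sub hI
  set X : Au := sh (-4) * per (lift m) * (sh (-4))⁻¹ with hX
  have hXG : X ∈ GP := mul_mem (mul_mem (sh_GP _) (per_GP hB hD)) (inv_mem (sh_GP _))
  have hdG : per del ∈ GP := per_GP del_Blk del_D
  have hdfix : ∀ s v, -1 / 2 ≤ s → s < 1 / 2 → per del (s :: v) = s :: v := by
    intro s v h1 h2
    have base : ∀ ρ v, 0 ≤ ρ → ρ < 8 → ρ ∉ Set.Ico (1 / 2 : ℚ) (15 / 2) →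
        per del (ρ :: v) = ρ :: v := by
      intro ρ v h0 h8 h
      rw [per_base del_Blk h0 h8, del_InH _ _ h]
    by_cases h : 0 ≤ s
    · exact base s v h (by linarith) (fun h' => by linarith [h'.1])
    · have e : s :: v = sh (8 * ((-1 : ℤ) : ℚ)) ((s + 8) :: v) := by simp
      rw [e, hdG.1, base (s + 8) v (by linarith) (by linarith) (fun h' => by linarith [h'.2])]
  obtain ⟨y, y1, y2, y3⟩ := extract_GP (f := X * per del * X⁻¹)
    (mul_mem (mul_mem hXG hdG) (inv_mem hXG)) (by
      intro r v h1 h2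
      have h3 : 7 / 2 ≤ m⁻¹ (r + 4) := (inv_le e1 _).1.mpr (by linarith)
      have h4 : m⁻¹ (r + 4) < 9 / 2 := (inv_le e2 _).2.1.mpr (by linarith)
      have hx : X⁻¹ (r :: v) = (m⁻¹ (r + 4) - 4) :: v := by
        apply inv_apply_of
        rw [hX, ← sh_neg]
        simp only [RelIso.mul_apply, sh_cons]
        rw [show m⁻¹ (r + 4) - 4 + - -4 = m⁻¹ (r + 4) by ring,
          per_base hB (by linarith) (by linarith), lift_cons]
        simp
      simp only [RelIso.mul_apply]
      rw [hx, hdfix _ _ (by linarith) (by linarith), ← hx]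
      simp)
  exact ⟨lift m, y, ⟨hD, hI⟩, ⟨y1, y2⟩, y3.symm⟩

theorem Y0_ex : ∃ Y0 : Set Au, Y0.Countable ∧ (∀ y ∈ Y0, y ∈ D ∧ y ∈ InH I7) ∧
    (∀ b u', 1 < b → b < 7 → ∃ f ∈ Y0, ∀ w, f (4 :: w) = b :: u' ++ w) ∧
    ∀ (H K : Subgroup Au), (∀ h ∈ H, ∀ x ∈ K, h * x * h⁻¹ ∈ K) → (∀ y ∈ Y0, per y ∈ K) →
      ∀ G, sh 1 ∈ H → sa G ∈ H → sb ∈ H → sh 1 ∈ K ∧ per del ∈ K ∧ sa G ∈ K ∧ sb ∈ K := by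
  classical
  obtain ⟨q, p, Pq, Pp, q1, q2, q3, q4⟩ := q_ex
  obtain ⟨q', p', Pq', Pp', q1', q2', q3', q4'⟩ := q'_ex
  obtain ⟨x, y, Px, Py, hxy⟩ := eta_ex
  obtain ⟨x', y', Px', Py', hxy'⟩ := delta_ex
  have mv : ∀ bu : ℚ × T, ∃ f : Au, (f ∈ D ∧ f ∈ InH I7) ∧
      (1 < bu.1 → bu.1 < 7 → ∀ w, f (4 :: w) = bu.1 :: bu.2 ++ w) := by
    rintro ⟨b, u⟩
    by_cases h : 1 < b ∧ b < 7
    · obtain ⟨f, f1, f2, f3⟩ := mover u b 1 7 4 (by norm_num) (by norm_num) h.1 h.2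
      exact ⟨f, ⟨f1, InH.mono Set.Ioo_subset_Ico_self f2⟩, fun _ _ => f3⟩
    · exact ⟨1, ⟨one_mem _, one_mem _⟩, fun h1 h2 => absurd ⟨h1, h2⟩ h⟩
  choose mv hmv1 hmv2 using mv
  refine ⟨Set.range mv ∪ ({lift q, lift p, lift q', lift p', x, y, x', y'} : Set Au), ?_, ?_, ?_, ?_⟩
  · exact (Set.countable_range mv).union (Set.toFinite _).countable
  · rintro f (⟨bu, rfl⟩ | hf)
    · exact hmv1 bu
    · simp only [Set.mem_insert_iff, Set.mem_singleton_iff] at hf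
      rcases hf with rfl | rfl | rfl | rfl | rfl | rfl | rfl | rfl <;> assumption
  · intro b u' h1 h2
    exact ⟨mv (b, u'), Or.inl ⟨_, rfl⟩, hmv2 (b, u') h1 h2⟩
  · intro H K hn hK G h1 ha hb
    have m : ∀ f ∈ ({lift q, lift p, lift q', lift p', x, y, x', y'} : Set Au), per f ∈ K :=
      fun f hf => hK f (Or.inr hf)
    have kq := m (lift q) (by simp)
    have kp := m (lift p) (by simp)
    have kq' := m (lift q') (by simp)
    have kp' := m (lift p') (by simp)
    have kx := m x (by simp)
    have ky := m y (by simp)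
    have kx' := m x' (by simp)
    have ky' := m y' (by simp)
    have hsh : ∀ n : ℤ, sh n ∈ H := by
      intro n
      have := zpow_mem h1 n
      rwa [← sh_int, one_mul] at this
    have hm2 : sh (-2) ∈ H := by simpa using hsh (-2)
    have hm4 : sh (-4) ∈ H := by simpa using hsh (-4)
    refine ⟨?_, ?_, ?_, ?_⟩
    · rw [hxy]
      exact mul_mem (hn _ hm2 _ kx) (hn _ h1 _ ky)
    · have hX := hn _ hm4 _ kx'
      have : per del = (sh (-4) * per x' * (sh (-4))⁻¹)⁻¹ * per y' * (sh (-4) * per x' * (sh (-4))⁻¹) := by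
        rw [← hxy']; group
      rw [this]
      exact mul_mem (mul_mem (inv_mem hX) ky') hX
    · refine absorb_mem (sa_absorb G (blk_of I7_sub Pq.2) (blk_of I7_sub Pp.2) q1 q2 q3 q4) kq kp ?_
      have := hn _ (inv_mem ha) _ kq
      rwa [inv_inv] at this
    · refine absorb_mem (sb_absorb (blk_of I7_sub Pq'.2) (blk_of I7_sub Pp'.2) q1' q2' q3' q4') kq' kp' ?_
      have := hn _ (inv_mem hb) _ kq'
      rwa [inv_inv] at this

end FL


namespace FL
open scoped commutatorElement

theorem comm_supp {W : Set T} {x y k : Au} (hx : ∀ l, l ∉ W → x l = l) (hy : ∀ l, l ∉ W → y l = l)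
    (hk : ∀ l ∈ W, k l ∉ W) : (k * x⁻¹ * k⁻¹) * y = y * (k * x⁻¹ * k⁻¹) := by
  have pres : ∀ {z : Au}, (∀ l, l ∉ W → z l = l) → ∀ l ∈ W, z l ∈ W := by
    intro z hz l hl
    by_contra h
    have := z.injective (hz _ h)
    rw [this] at h; exact h hl
  have hxi : ∀ l, l ∉ W → x⁻¹ l = l := fun l hl => inv_apply_of (hx l hl)
  have zfix : ∀ l, k⁻¹ l ∉ W → (k * x⁻¹ * k⁻¹) l = l := by
    intro l hl
    simp only [RelIso.mul_apply, hxi _ hl, RelIso.apply_inv_self]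
  apply au_ext
  intro l
  change (k * x⁻¹ * k⁻¹) (y l) = y ((k * x⁻¹ * k⁻¹) l)
  by_cases hl : l ∈ W
  · have key : ∀ l ∈ W, k⁻¹ l ∉ W := by
      intro l hl h
      have := hk _ h
      rw [RelIso.apply_inv_self] at this; exact this hl
    rw [zfix l (key l hl), zfix _ (key _ (pres hy l hl))]
  · rw [hy l hl]
    by_cases h2 : k⁻¹ l ∈ W
    · have : (k * x⁻¹ * k⁻¹) l ∉ W := by
        simp only [RelIso.mul_apply]
        exact hk _ (pres hxi _ h2)
      rw [hy _ this]
    · rw [zfix l h2, hy l hl]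

theorem dbl_comm {H K : Subgroup Au} (hn : ∀ h ∈ H, ∀ x ∈ K, h * x * h⁻¹ ∈ K) {x y k : Au}
    (hxH : x ∈ H) (hyH : y ∈ H) (hkK : k ∈ K)
    (hc : (k * x⁻¹ * k⁻¹) * y = y * (k * x⁻¹ * k⁻¹)) : ⁅x, y⁆ ∈ K := by
  have h1 : x * k * x⁻¹ * k⁻¹ ∈ K := K.mul_mem (hn x hxH k hkK) (K.inv_mem hkK)
  have h2 : (x * k * x⁻¹ * k⁻¹) * (y * (x * k * x⁻¹ * k⁻¹)⁻¹ * y⁻¹) ∈ K :=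
    K.mul_mem h1 (hn y hyH _ (K.inv_mem h1))
  have h3 : (x * k * x⁻¹ * k⁻¹) * (y * (x * k * x⁻¹ * k⁻¹)⁻¹ * y⁻¹) = ⁅x, y⁆ := by
    have e1 : (x * k * x⁻¹ * k⁻¹) = x * (k * x⁻¹ * k⁻¹) := by group
    rw [e1, commutatorElement_def]
    calc x * (k * x⁻¹ * k⁻¹) * (y * (x * (k * x⁻¹ * k⁻¹))⁻¹ * y⁻¹)
        = x * ((k * x⁻¹ * k⁻¹) * y) * (k * x⁻¹ * k⁻¹)⁻¹ * x⁻¹ * y⁻¹ := by group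
      _ = x * y * x⁻¹ * y⁻¹ := by rw [hc]; group
  rwa [h3] at h2

theorem ga_supp (e : ℕ) (g : Au) (l : T)
    (h : ¬ ∃ (n : ℤ) (w : T), l = sh (8 * 4 ^ e * (n : ℚ)) (4 :: 0 :: w)) : ga e g l = l := by
  cases l with
  | nil => exact app_nil _
  | cons ρ v =>
    by_cases hρ : ∃ n : ℤ, ρ = 8 * 4 ^ e * n + 4
    · obtain ⟨n, rfl⟩ := hρ
      rw [ga_cons]
      cases v with
      | nil => rw [app_nil]
      | cons s w =>
        by_cases hs : s = 0
        · subst hs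
          exact absurd ⟨n, w, by rw [sh_cons]; congr 1; ring⟩ h
        · rw [at1_other hs]
    · exact ga_cons' hρ v

theorem append_sep {u1 u' w w' : List ℚ} {a b : ℚ} (h : u1 ++ b :: w = u' ++ a :: w')
    (ha : a ∉ u1) (hb : b ∉ u') : u1 = u' := by
  induction u1 generalizing u' with
  | nil =>
    cases u' with
    | nil => rfl
    | cons c u' => simp at h; simp [h.1] at hb
  | cons d u1 ih =>
    cases u' with
    | nil => simp at h; simp [h.1] at ha
    | cons c u' =>
      simp only [List.cons_append, List.cons.injEq] at h
      simp only [List.mem_cons, not_or] at ha hb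
      rw [h.1, ih h.2 ha.2 hb.2]

theorem exists_le_avoid (σ : Qa) (u1 u' : List ℚ) (a0 : ℚ) : ∃ a ≤ a0, a ∉ u1 ∧ σ a ∉ u' := by
  have hfin : ({x | x ∈ u1} ∪ σ ⁻¹' {x | x ∈ u'}).Finite :=
    (List.finite_toSet u1).union ((List.finite_toSet u').preimage σ.injective.injOn)
  obtain ⟨a, ha, hb⟩ := (Set.Iic_infinite a0).exists_notMem_finite hfin
  simp only [Set.mem_union, Set.mem_ofPred_eq, Set.mem_preimage, not_or] at hb
  exact ⟨a, ha, hb⟩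

theorem core_simple {H K : Subgroup Au} (hn : ∀ h ∈ H, ∀ x ∈ K, h * x * h⁻¹ ∈ K) {Y0 S : Set Au}
    (hYb : ∀ y ∈ Y0, y ∈ Blk)
    (hYt : ∀ (b : ℚ) (u' : List ℚ), 1 < b → b < 7 → ∃ f ∈ Y0, ∀ w : List ℚ, f (4 :: w) = b :: u' ++ w)
    (hYH : ∀ y ∈ Y0, per y ∈ H) (hsh : ∀ k : ℤ, sh (k : ℚ) ∈ H)
    (hga : ∀ g ∈ S, ∀ e, ga e g ∈ H)
    {k : Au} (hkK : k ∈ K) (hk1 : k ≠ 1) (hkG : Good Set.univ k)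
    {g1 g2 : Au} (h1 : g1 ∈ S) (h2 : g2 ∈ S) : ⁅ga 0 g1, ga 0 g2⁆ ∈ K := by
  obtain ⟨p, hp⟩ : ∃ p, k p ≠ p := by
    by_contra hh; push Not at hh; exact hk1 (au_ext fun l => hh l)
  cases p with
  | nil => exact absurd (app_nil k) hp
  | cons r u' =>
  obtain ⟨r1, u1, hkp⟩ := app_cons k r u'
  obtain ⟨σ, -, hσ⟩ := hkG (r :: u') (by simp)
  obtain ⟨e0, a0, hup⟩ := hσ.up
  obtain ⟨e1, he1⟩ := pow_unbounded_of_one_lt (|r1 - r|) (show (1:ℚ) < 4 by norm_num)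
  obtain ⟨a, haa, hau, hσu⟩ := exists_le_avoid σ u1 u' a0
  set e := max e0 e1 with he
  have hup := hup e (le_max_left _ _)
  have hN : |r1 - r| < 8 * 4 ^ e := by
    have : (4:ℚ) ^ e1 ≤ 4 ^ e := pow_le_pow_right₀ (by norm_num) (le_max_right _ _)
    have h4 : (0:ℚ) < 4 ^ e := by positivity
    linarith
  set N : ℚ := 8 * 4 ^ e with hNdef
  have hNpos : 0 < N := by positivity
  let W : Set T := {l | ∃ (n : ℤ) (w : T), l = sh (N * (n : ℚ)) (r :: u' ++ a :: w)}
  have hkW : ∀ l ∈ W, k l ∉ W := by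
    rintro _ ⟨n, w, rfl⟩ ⟨m, w', hm⟩
    rw [hup n a haa w, hkp] at hm
    simp only [List.cons_append, sh_cons, List.cons.injEq] at hm
    obtain ⟨hm1, hm2⟩ := hm
    have hu := append_sep hm2 hau hσu
    have h3 : r1 - r = N * ((m - n : ℤ) : ℚ) := by push_cast; linarith
    rw [h3, abs_mul, abs_of_pos hNpos] at hN
    have h5 : |((m - n : ℤ) : ℚ)| < 1 := by
      by_contra hc
      push Not at hc
      nlinarith
    have h6 : m - n = 0 := by
      have : |m - n| < 1 := by exact_mod_cast h5
      exact Int.abs_lt_one_iff.1 this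
    rw [h6] at h3
    apply hp
    rw [hkp, hu]
    congr 1
    simp at h3; linarith
  obtain ⟨mz, hmz, hmz'⟩ := hYt 4 [0] (by norm_num) (by norm_num)
  obtain ⟨mp, hmp, hmp'⟩ := hYt (r - (⌊r⌋ - 3 : ℤ)) (u' ++ [a])
    (by push_cast; linarith [Int.floor_le r]) (by push_cast; linarith [Int.lt_floor_add_one r])
  set i : ℤ := ⌊r⌋ - 3 with hi
  set h : Au := sh (i : ℚ) * per mp * (per mz)⁻¹ with hh
  have hhH : h ∈ H := H.mul_mem (H.mul_mem (hsh _) (hYH _ hmp)) (H.inv_mem (hYH _ hmz))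
  have hNe : ∀ n : ℤ, N * (n : ℚ) = 8 * ((4 ^ e * n : ℤ) : ℚ) := by
    intro n; rw [hNdef]; push_cast; ring
  have hhZ : ∀ (n : ℤ) (w : T), h (sh (N * (n : ℚ)) (4 :: 0 :: w)) =
      sh (N * (n : ℚ)) (r :: u' ++ a :: w) := by
    intro n w
    rw [hNe]
    have e1 : (per mz)⁻¹ (sh (8 * ((4 ^ e * n : ℤ) : ℚ)) (4 :: 0 :: w)) =
        sh (8 * ((4 ^ e * n : ℤ) : ℚ)) (4 :: w) := by
      apply inv_apply_of
      rw [per_sh, per_base (hYb _ hmz) (by norm_num) (by norm_num), hmz']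
      rfl
    rw [hh]
    simp only [RelIso.mul_apply]
    rw [e1, per_sh, per_base (hYb _ hmp) (by norm_num) (by norm_num), hmp']
    simp only [List.cons_append, sh_cons, List.append_assoc, List.nil_append]
    congr 1
    ring
  have hsupp : ∀ g, ∀ l, l ∉ W → (h * ga e g * h⁻¹) l = l := by
    intro g l hl
    simp only [RelIso.mul_apply]
    rw [ga_supp, RelIso.apply_inv_self]
    rintro ⟨n, w, hnw⟩
    apply hl
    refine ⟨n, w, ?_⟩
    rw [← hhZ, ← hnw, RelIso.apply_inv_self]
  have hx : ∀ g ∈ S, h * ga e g * h⁻¹ ∈ H := fun g hg =>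
    H.mul_mem (H.mul_mem hhH (hga g hg e)) (H.inv_mem hhH)
  have hfin := dbl_comm hn (hx g1 h1) (hx g2 h2) hkK (comm_supp (hsupp g1) (hsupp g2) hkW)
  have hfin2 := hn h⁻¹ (H.inv_mem hhH) _ hfin
  have hfin3 : h⁻¹ * ⁅h * ga e g1 * h⁻¹, h * ga e g2 * h⁻¹⁆ * h⁻¹⁻¹ = ga e ⁅g1, g2⁆ := by
    rw [map_commutatorElement]
    simp only [commutatorElement_def]
    group
  rw [hfin3] at hfin2
  have := ga_down (K := K) (fun k x hx => hn _ (by exact_mod_cast hsh (8 * k)) x hx) (Nat.zero_le e) hfin2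
  rwa [map_commutatorElement] at this

end FL


namespace FL
open scoped commutatorElement

/-- The embedding of the automorphisms of the rationals. -/
noncomputable def Phi : Qa →* Au := (ga 0).comp lift

theorem Phi_z (σ : Qa) (n : ℤ) (a : ℚ) (w : T) :
    Phi σ ((8 * (n : ℚ) + 4) :: 0 :: a :: w) = (8 * (n : ℚ) + 4) :: 0 :: σ a :: w := by
  have := ga_cons 0 (lift σ) n (0 :: a :: w)
  simp only [pow_zero, mul_one, at1_same, lift_cons] at this
  exact this

theorem Phi_z0 (σ : Qa) (n : ℤ) : Phi σ [8 * (n : ℚ) + 4, 0] = [8 * (n : ℚ) + 4, 0] := by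
  have := ga_cons 0 (lift σ) n [0]
  simp only [pow_zero, mul_one, at1_same, app_nil] at this
  exact this

theorem Phi_supp (σ : Qa) (l : T)
    (h : ¬ ∃ (n : ℤ) (w : T), l = (8 * (n : ℚ) + 4) :: 0 :: w) : Phi σ l = l := by
  apply ga_supp
  rintro ⟨n, w, hn⟩
  apply h
  refine ⟨n, w, ?_⟩
  rw [hn, sh_cons]
  congr 1
  ring

theorem Phi_z' (σ : Qa) (a : ℚ) (w : T) : Phi σ (4 :: 0 :: a :: w) = 4 :: 0 :: σ a :: w := by
  have := Phi_z σ 0 a w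
  simpa using this

theorem Phi_inj : Function.Injective Phi := by
  intro σ τ h
  apply DFunLike.ext
  intro a
  have h1 := Phi_z' σ a []
  rw [h, Phi_z' τ a []] at h1
  simp at h1
  exact h1.symm

theorem core_frattini {C : Subgroup Qa} (hfree : ∀ σ ∈ C, ∀ a, σ a = a → σ = 1) {h : Au}
    (hh : Good (C : Set Qa) h) {g g' : Qa} (hg : g ∈ C) (hg' : g' ∈ C)
    (he : h * Phi g = Phi g' * h) : ∃ c ∈ C, c * g = g' * c := by
  obtain ⟨c, hc, hG⟩ := hh [4, 0] (by simp)
  obtain ⟨a0, ha0⟩ := hG.germ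
  have hap : ∀ l, h (Phi g l) = Phi g' (h l) := fun l => by
    rw [← RelIso.mul_apply, he]; rfl
  have hz : Phi g [4, 0] = [4, 0] := by simpa using Phi_z0 g 0
  have hv : Phi g' (h [4, 0]) = h [4, 0] := by rw [← hap, hz]
  have triv : g' = 1 → ∃ c ∈ C, c * g = g' * c := by
    rintro rfl
    rw [map_one, one_mul, mul_eq_left] at he
    have : g = 1 := Phi_inj (by rw [he, map_one])
    exact ⟨1, C.one_mem, by rw [this]⟩
  have main : ∀ a1 (τ : Qa), (∀ a ≤ a1, Phi g' (h [4, 0] ++ [a]) = h [4, 0] ++ [τ a]) →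
      ∃ a, c (g a) = τ (c a) := by
    intro a1 τ hτ
    set a := min a0 (min (g⁻¹ a0) (c⁻¹ a1)) with ha
    have h1 : a ≤ a0 := min_le_left _ _
    have h2 : g a ≤ a0 := by
      have : a ≤ g⁻¹ a0 := (min_le_right _ _).trans (min_le_left _ _)
      calc g a ≤ g (g⁻¹ a0) := g.monotone this
        _ = a0 := RelIso.apply_inv_self _ _
    have h3 : c a ≤ a1 := by
      have : a ≤ c⁻¹ a1 := (min_le_right _ _).trans (min_le_right _ _)
      calc c a ≤ c (c⁻¹ a1) := c.monotone this
        _ = a1 := RelIso.apply_inv_self _ _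
    have e1 := hap ([4, 0] ++ a :: [])
    have e2 : Phi g ([4, 0] ++ a :: []) = [4, 0] ++ g a :: [] := Phi_z' g a []
    rw [e2, ha0 _ h2, ha0 _ h1, hτ _ h3] at e1
    refine ⟨a, ?_⟩
    simpa using e1
  have done1 : ∀ a1, (∀ a ≤ a1, Phi g' (h [4, 0] ++ [a]) = h [4, 0] ++ [a]) →
      ∃ c ∈ C, c * g = g' * c := by
    intro a1 h1
    obtain ⟨a, ha⟩ := main a1 1 (by simpa using h1)
    have : g a = a := c.injective ha
    have hg1 := hfree g hg a this
    rw [hg1, map_one, mul_one, right_eq_mul] at he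
    exact triv (Phi_inj (by rw [he, map_one]))
  by_cases hcase : ∃ (n : ℤ) (w : T), h [4, 0] = (8 * (n : ℚ) + 4) :: 0 :: w
  · obtain ⟨n, w, hw⟩ := hcase
    cases w with
    | nil =>
      obtain ⟨a, ha⟩ := main 0 g' (fun a _ => by rw [hw]; exact Phi_z g' n a [])
      refine ⟨c, hc, ?_⟩
      have h1 : (g' * c)⁻¹ * (c * g) ∈ C :=
        C.mul_mem (C.inv_mem (C.mul_mem hg' hc)) (C.mul_mem hc hg)
      have h2 := hfree _ h1 a (by
        have : (g' * c)⁻¹ ((c * g) a) = a := inv_apply_of ha.symm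
        exact this)
      exact (inv_mul_eq_one.1 h2).symm
    | cons b w =>
      rw [hw, Phi_z] at hv
      simp only [List.cons.injEq, true_and, and_true] at hv
      exact triv (hfree g' hg' b hv)
  · apply done1 (-1)
    intro a ha
    apply Phi_supp
    rintro ⟨n, w, hw⟩
    obtain ⟨r, v, hrv⟩ := app_cons h 4 [0]
    rw [hrv] at hw hcase
    simp only [List.cons_append, List.cons.injEq] at hw
    obtain ⟨rfl, hw⟩ := hw
    cases v with
    | nil => simp at hw; linarith [hw.1]
    | cons s v =>
      simp only [List.cons_append, List.cons.injEq] at hw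
      exact hcase ⟨n, v, by rw [hw.1]⟩

theorem good_word {F0 : Set Qa} {Y : Set Au} (hY : ∀ y ∈ Y, Good (insert 1 F0) y) (w : List Au)
    (hw : ∀ a ∈ w, a ∈ Y ∨ a⁻¹ ∈ Y) :
    Good {σ | ∃ l : List Qa, l.length = w.length ∧ (∀ x ∈ l, x ∈ F0 ∨ x⁻¹ ∈ F0 ∨ x = 1) ∧
      l.prod = σ} w.prod := by
  induction w with
  | nil =>
    have : Good {1} (sh 0) := good_sh 0
    rw [sh_zero] at this
    refine this.mono ?_
    rintro _ rfl
    exact ⟨[], rfl, by simp, rfl⟩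
  | cons a w ih =>
    have h1 := ih fun b hb => hw b (by simp [hb])
    have h2 : Good {x | x ∈ F0 ∨ x⁻¹ ∈ F0 ∨ x = 1} a := by
      rcases hw a (by simp) with h | h
      · refine (hY a h).mono ?_
        rintro x (rfl | hx)
        · exact Or.inr (Or.inr rfl)
        · exact Or.inl hx
      · have := (hY _ h).inv
        rw [inv_inv] at this
        refine this.mono ?_
        intro x hx
        rcases Set.mem_inv.1 hx with hx | hx
        · exact Or.inr (Or.inr (inv_eq_one.1 hx))
        · exact Or.inr (Or.inl hx)
    rw [List.prod_cons]
    refine (h2.mul h1).mono ?_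
    rintro _ ⟨x, hx, _, ⟨l, hl1, hl2, rfl⟩, rfl⟩
    refine ⟨x :: l, by simp [hl1], ?_, by simp⟩
    intro y hy
    rcases List.mem_cons.1 hy with rfl | hy
    · exact hx
    · exact hl2 y hy

theorem good_closure {F0 : Set Qa} {Y : Set Au} (hY : ∀ y ∈ Y, Good (insert 1 F0) y) {h : Au}
    (hh : h ∈ Subgroup.closure Y) : Good (Subgroup.closure F0 : Set Qa) h := by
  induction hh using Subgroup.closure_induction with
  | mem x hx =>
    refine (hY x hx).mono ?_
    rintro y (rfl | hy)
    · exact one_mem _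
    · exact Subgroup.subset_closure hy
  | one =>
    have : Good {1} (sh 0) := good_sh 0
    rw [sh_zero] at this
    refine this.mono ?_
    rintro _ rfl
    exact one_mem _
  | mul x y _ _ hx hy =>
    refine (hx.mul hy).mono ?_
    rintro _ ⟨a, ha, b, hb, rfl⟩
    exact mul_mem ha hb
  | inv x _ hx =>
    refine hx.inv.mono ?_
    intro a ha
    have := Subgroup.inv_mem (Subgroup.closure F0) (Set.mem_inv.1 ha)
    rwa [inv_inv] at this

theorem core (F0 : Set Qa) (hF : F0.Countable)
    (hfree : ∀ σ ∈ Subgroup.closure F0, ∀ a, σ a = a → σ = 1) :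
    ∃ Y : Finset Au, IsSimpleGroup (Subgroup.closure (Y : Set Au)) ∧
      (∀ σ ∈ Subgroup.closure F0, Phi σ ∈ Subgroup.closure (Y : Set Au)) ∧
      (∀ σ ∈ Subgroup.closure F0, ∀ w : List Au, (∀ a ∈ w, a ∈ Y ∨ a⁻¹ ∈ Y) → w.prod = Phi σ →
        ∃ l : List Qa, l.length = w.length ∧ (∀ x ∈ l, x ∈ F0 ∨ x⁻¹ ∈ F0 ∨ x = 1) ∧ l.prod = σ) ∧
      (∀ g ∈ Subgroup.closure F0, ∀ g' ∈ Subgroup.closure F0,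
        ∀ h ∈ Subgroup.closure (Y : Set Au), h * Phi g = Phi g' * h →
          ∃ c ∈ Subgroup.closure F0, c * g = g' * c) := by
  classical
  obtain ⟨Y0, hYc, hYD, hYt, hYK⟩ := Y0_ex
  have hYb : ∀ y ∈ Y0, y ∈ Blk := fun y hy => blk_of I7_sub (hYD y hy).2
  choose! gy hgyD hgy using fun y (hy : y ∈ Y0) => compress_per (hYD y hy).1 (hYD y hy).2
  let S : Set Au := insert t (lift '' F0 ∪ (fun y => plus (gy y)) '' Y0)
  have hSc : S.Countable := ((hF.image _).union (hYc.image _)).insert _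
  obtain ⟨f, hf⟩ := hSc.exists_eq_range ⟨t, Set.mem_insert _ _⟩
  let G : ℕ → Au := fun k => f (Nat.unpair k).1
  have hG1 : ∀ n, G n ∈ S := fun n => hf ▸ Set.mem_range_self _
  have hG2 : ∀ g ∈ S, ∀ e, ∃ j ≥ e, G j = g := by
    intro g hg e
    rw [hf] at hg
    obtain ⟨m, rfl⟩ := hg
    exact ⟨Nat.pair m e, Nat.right_le_pair _ _, by simp [G]⟩
  have hSA : ∀ g ∈ S, Str (insert 1 F0) g := by
    have h1 : (1 : Qa) ∈ insert 1 F0 := Set.mem_insert _ _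
    rintro _ (rfl | ⟨x, hx, rfl⟩ | ⟨y, hy, rfl⟩)
    · exact str_of_D h1 t_mem_D
    · rintro (_ | ⟨r, u⟩)
      · exact ⟨x, Set.mem_insert_of_mem _ hx, germ_lift_nil x⟩
      · exact ⟨1, h1, germ_lift_cons x r u⟩
    · exact plus_str h1 (str_of_D h1 (hgyD y hy))
  let Y : Finset Au := {sh 1, sa G, sb, per del}
  have hYgood : ∀ y ∈ (Y : Set Au), Good (insert 1 F0) y := by
    have h1 : ({1} : Set Qa) ⊆ insert 1 F0 := by simp
    intro y hy
    simp only [Y, Finset.coe_insert, Finset.coe_singleton, Set.mem_insert_iff,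
      Set.mem_singleton_iff] at hy
    rcases hy with rfl | rfl | rfl | rfl
    · exact (good_sh 1).mono h1
    · exact good_sa (Set.mem_insert _ _) fun n => hSA _ (hG1 n)
    · exact good_sb.mono h1
    · exact (good_per del_Blk del_D).mono h1
  set H := Subgroup.closure (Y : Set Au) with hH
  have m1 : sh 1 ∈ H := Subgroup.subset_closure (by simp [Y])
  have m2 : sa G ∈ H := Subgroup.subset_closure (by simp [Y])
  have m3 : sb ∈ H := Subgroup.subset_closure (by simp [Y])
  have m4 : per del ∈ H := Subgroup.subset_closure (by simp [Y])
  have hsh : ∀ k : ℤ, sh (k : ℚ) ∈ H := by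
    intro k
    have := H.zpow_mem m1 k
    rwa [← sh_int, one_mul] at this
  have hsh8 : ∀ k : ℤ, sh (8 * (k : ℚ)) ∈ H := fun k => by exact_mod_cast hsh (8 * k)
  have hga : ∀ g ∈ S, ∀ e, ga e g ∈ H := by
    intro g hg e
    obtain ⟨j, hj, rfl⟩ := hG2 g hg e
    exact ga_down (fun k x hx => H.mul_mem (H.mul_mem (hsh8 k) hx) (H.inv_mem (hsh8 k)))
      (by omega : e ≤ j + 1) (ga_mem hsh8 m2 m3 j)
  have htS : t ∈ S := Set.mem_insert _ _
  have hpS : ∀ y ∈ Y0, plus (gy y) ∈ S := fun y hy => Or.inr (Or.inr ⟨y, hy, rfl⟩)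
  have hper : ∀ K : Subgroup Au, (∀ h ∈ H, ∀ x ∈ K, h * x * h⁻¹ ∈ K) →
      (∀ g1 ∈ S, ∀ g2 ∈ S, ⁅ga 0 g1, ga 0 g2⁆ ∈ K) → ∀ y ∈ Y0, per y ∈ K := by
    intro K hn hK y hy
    have h1 := hK _ (hpS y hy) t htS
    rw [← hgy y hy] at h1
    have h2 := hn _ (H.inv_mem m4) _ h1
    have h3 : (per del)⁻¹ * (per del * per y * (per del)⁻¹) * (per del)⁻¹⁻¹ = per y := by group
    rwa [h3] at h2
  have hHn : ∀ h ∈ H, ∀ x ∈ H, h * x * h⁻¹ ∈ H := fun h hh x hx =>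
    H.mul_mem (H.mul_mem hh hx) (H.inv_mem hh)
  have hYH : ∀ y ∈ Y0, per y ∈ H := hper H hHn fun g1 h1 g2 h2 => by
    rw [commutatorElement_def]
    exact H.mul_mem (H.mul_mem (H.mul_mem (hga _ h1 0) (hga _ h2 0)) (H.inv_mem (hga _ h1 0)))
      (H.inv_mem (hga _ h2 0))
  have hsimple : ∀ K : Subgroup Au, K ≤ H → (∀ h ∈ H, ∀ x ∈ K, h * x * h⁻¹ ∈ K) →
      ∀ k ∈ K, k ≠ 1 → H ≤ K := by
    intro K hKH hn k hk hk1
    have hY := hper K hn fun g1 h1 g2 h2 =>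
      core_simple hn hYb hYt hYH hsh hga hk hk1
        ((good_closure hYgood (hKH hk)).mono (Set.subset_univ _)) h1 h2
    obtain ⟨k1, k2, k3, k4⟩ := hYK H K hn hY G m1 m2 m3
    rw [hH, Subgroup.closure_le]
    intro y hy
    simp only [Y, Finset.coe_insert, Finset.coe_singleton, Set.mem_insert_iff,
      Set.mem_singleton_iff] at hy
    rcases hy with rfl | rfl | rfl | rfl <;> assumption
  refine ⟨Y, ?_, ?_, ?_, ?_⟩
  · have hnt : Nontrivial H := by
      refine ⟨⟨sh 1, m1⟩, 1, ?_⟩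
      intro h
      have h1 : sh 1 = 1 := congrArg Subtype.val h
      have h2 : sh 1 [0] = [0] := by rw [h1]; rfl
      rw [sh_cons] at h2
      simp at h2
    refine { toNontrivial := hnt, eq_bot_or_eq_top_of_normal := ?_ }
    intro N hN
    by_cases hbot : N = ⊥
    · exact Or.inl hbot
    right
    obtain ⟨k, hkN, hk1⟩ : ∃ k ∈ N, k ≠ 1 := by
      by_contra hc
      push Not at hc
      exact hbot ((Subgroup.eq_bot_iff_forall N).2 hc)
    have := hsimple (N.map H.subtype) (by rintro _ ⟨x, -, rfl⟩; exact x.2)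
      (by
        rintro h hh _ ⟨x, hx, rfl⟩
        exact ⟨⟨h, hh⟩ * x * ⟨h, hh⟩⁻¹, hN.conj_mem x hx _, rfl⟩)
      k ⟨k, hkN, rfl⟩ (fun h => hk1 (Subtype.ext h))
    rw [eq_top_iff]
    intro x _
    obtain ⟨y, hy, hyx⟩ := this x.2
    have : y = x := Subtype.ext hyx
    rwa [← this]
  · intro σ hσ
    induction hσ using Subgroup.closure_induction with
    | mem x hx => exact hga _ (Or.inr (Or.inl ⟨x, hx, rfl⟩)) 0
    | one => rw [map_one]; exact H.one_mem
    | mul x y _ _ hx hy => rw [map_mul]; exact H.mul_mem hx hy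
    | inv x _ hx => rw [map_inv]; exact H.inv_mem hx
  · intro σ hσ w hw hprod
    obtain ⟨τ, ⟨l, hl1, hl2, hl3⟩, hG⟩ := good_word hYgood w hw [4, 0] (by simp)
    refine ⟨l, hl1, hl2, ?_⟩
    rw [hl3]
    obtain ⟨a0, ha0⟩ := hG.germ
    have h1 := ha0 a0 le_rfl []
    rw [hprod] at h1
    have h2 : Phi σ [4, 0] = [4, 0] := by simpa using Phi_z0 σ 0
    rw [h2] at h1
    have h3 : Phi σ ([4, 0] ++ a0 :: []) = _ := Phi_z' σ a0 []
    rw [h3] at h1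
    have h4 : σ a0 = τ a0 := by simpa using h1
    have hτ : τ ∈ Subgroup.closure F0 := by
      rw [← hl3]
      apply Subgroup.list_prod_mem
      intro x hx
      rcases hl2 x hx with h | h | rfl
      · exact Subgroup.subset_closure h
      · have := Subgroup.inv_mem (Subgroup.closure F0) (Subgroup.subset_closure h)
        rwa [inv_inv] at this
      · exact one_mem _
    have h5 := hfree _ (mul_mem (inv_mem hσ) hτ) a0 (inv_apply_of h4)
    exact (inv_mul_eq_one.1 h5).symm
  · intro g hg g' hg' h hh he
    exact core_frattini hfree (good_closure hYgood hh) hg hg' he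

end FL


namespace FL

theorem lo_aux {Γ : Type} [Group Γ] (β : ℕ → Type) [∀ i, LinearOrder (β i)] (j : Γ → ∀ i, β i)
    (hj : Function.Injective j)
    (heq : ∀ a b c i, j b i = j c i → j (a * b) i = j (a * c) i)
    (hlt : ∀ a b c i, j b i < j c i → j (a * b) i < j (a * c) i) : IsLeftOrderable Γ := by
  have hinj : Function.Injective (fun g => (toLex (j g) : Πₗ i, β i)) :=
    fun a b h => hj (toLex.injective h)
  refine ⟨LinearOrder.lift' (fun g => (toLex (j g) : Πₗ i, β i)) hinj, ?_⟩
  intro a b c hbc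
  have hbc : (toLex (j b) : Πₗ i, β i) ≤ toLex (j c) := hbc
  change (toLex (j (a * b)) : Πₗ i, β i) ≤ toLex (j (a * c))
  rcases hbc.eq_or_lt with h | h
  · rw [hinj h]
  · apply le_of_lt
    obtain ⟨i, hi1, hi2⟩ := h
    exact ⟨i, fun k hk => heq _ _ _ _ (hi1 k hk), hlt _ _ _ _ hi2⟩

theorem lo_au (H : Subgroup Au) : IsLeftOrderable H := by
  obtain ⟨s, hs⟩ := exists_surjective_nat T
  refine lo_aux (fun _ => T) (fun h n => h.1 (s n)) ?_ ?_ ?_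
  · intro a b h
    apply Subtype.ext
    apply au_ext
    intro l
    obtain ⟨n, rfl⟩ := hs l
    exact congrFun h n
  · intro a b c i h
    exact congrArg a.1 h
  · intro a b c i h
    exact a.1.strictMono h

theorem lo_pi (G : ℕ → Type) [∀ i, Group (G i)] (hlo : ∀ i, IsLeftOrderable (G i))
    (Γ : Subgroup (∀ i, G i)) : IsLeftOrderable Γ := by
  choose l hl using hlo
  letI := l
  refine lo_aux G (fun h n => h.1 n) ?_ ?_ ?_
  · intro a b h
    exact Subtype.ext h
  · intro a b c i h
    exact congrArg (a.1 i * ·) h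
  · intro a b c i h
    refine lt_of_le_of_ne (hl i _ _ _ h.le) ?_
    intro h'
    exact h.ne (mul_left_cancel h')

theorem free_act (Γ : Type) [Group Γ] [Countable Γ] (hlo : IsLeftOrderable Γ) :
    ∃ act : Γ →* Qa, ∀ g a, act g a = a → g = 1 := by
  obtain ⟨l, hl⟩ := hlo
  letI := l
  have hl' : ∀ a b c : Γ, b ≤ c → a * b ≤ a * c := hl
  have hlt : ∀ a b c : Γ, a * b < a * c ↔ b < c := by
    intro a b c
    constructor
    · intro h
      by_contra hc
      exact absurd (hl' a c b (not_lt.1 hc)) (not_le.2 h)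
    · intro h
      exact lt_of_le_of_ne (hl' _ _ _ h.le) fun h' => h.ne (mul_left_cancel h')
  haveI : Countable (Γ ×ₗ ℚ) := inferInstanceAs (Countable (Γ × ℚ))
  obtain ⟨e⟩ := Order.iso_of_countable_dense (Γ ×ₗ ℚ) ℚ
  let m : Γ → (Γ ×ₗ ℚ) → (Γ ×ₗ ℚ) := fun g x => toLex (g * (ofLex x).1, (ofLex x).2)
  have m_mul : ∀ g h x, m (g * h) x = m g (m h x) := by
    intro g h x; simp [m, mul_assoc]
  have m_one : ∀ x, m 1 x = x := by
    intro x; simp [m]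
  have m_lt : ∀ g x y, x < y → m g x < m g y := by
    intro g x y h
    rw [Prod.Lex.lt_iff] at h ⊢
    rcases h with h | ⟨h1, h2⟩
    · exact Or.inl ((hlt _ _ _).2 h)
    · exact Or.inr ⟨congrArg (g * ·) h1, h2⟩
  have m_mono : ∀ g, StrictMono (m g) := fun g x y h => m_lt g x y h
  let o : Γ → Qa := fun g =>
    { toFun := fun q => e (m g (e.symm q))
      invFun := fun q => e (m g⁻¹ (e.symm q))
      left_inv := fun q => by simp [← m_mul, m_one]
      right_inv := fun q => by simp [← m_mul, m_one]
      map_rel_iff' := fun {a b} => by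
        change e (m g (e.symm a)) ≤ e (m g (e.symm b)) ↔ a ≤ b
        rw [e.le_iff_le, (m_mono g).le_iff_le, e.symm.le_iff_le] }
  have o_app : ∀ g q, o g q = e (m g (e.symm q)) := fun _ _ => rfl
  refine ⟨MonoidHom.mk' o ?_, ?_⟩
  · intro g h
    apply DFunLike.ext
    intro q
    rw [RelIso.mul_apply, o_app, o_app, o_app, m_mul, e.symm_apply_apply]
  · intro g a h
    have h : o g a = a := h
    rw [o_app, ← e.eq_symm_apply] at h
    have := congrArg (fun x => (ofLex x).1) h
    simpa [m] using this

theorem countable_closure {P : Type} [Group P] {S : Set P} (hS : S.Countable) :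
    Countable (Subgroup.closure S) := by
  haveI := hS.to_subtype
  haveI : Countable (FreeGroup S) := by
    unfold FreeGroup
    exact inferInstance
  have h : Subgroup.closure S = (FreeGroup.lift (Subtype.val : S → P)).range := by
    rw [FreeGroup.range_lift_eq_closure, Subtype.range_coe]
  rw [h]
  exact (FreeGroup.lift (Subtype.val : S → P)).rangeRestrict_surjective.countable

theorem wl_le {G : Type} [Group G] {X : Finset G} (w : List G) (hw : ∀ a ∈ w, a ∈ X ∨ a⁻¹ ∈ X) :
    wordLength X w.prod ≤ w.length := Nat.sInf_le ⟨w, rfl, hw, rfl⟩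

theorem wl_spec {G : Type} [Group G] {X : Finset G} (hX : Generates X) (g : G) :
    ∃ w : List G, w.length = wordLength X g ∧ (∀ a ∈ w, a ∈ X ∨ a⁻¹ ∈ X) ∧ w.prod = g := by
  have hg : g ∈ Subgroup.closure (X : Set G) := by rw [hX]; trivial
  rw [← Subgroup.mem_toSubmonoid, Subgroup.closure_toSubmonoid] at hg
  obtain ⟨l, hl1, hl2⟩ := Submonoid.exists_list_of_mem_closure hg
  exact Nat.sInf_mem (s := {n | ∃ w : List G, w.length = n ∧ (∀ a ∈ w, a ∈ X ∨ a⁻¹ ∈ X) ∧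
    w.prod = g}) ⟨l.length, l, rfl, fun a ha => hl1 a ha, hl2⟩

theorem wl_mul {G : Type} [Group G] {X : Finset G} (hX : Generates X) (g h : G) :
    wordLength X (g * h) ≤ wordLength X g + wordLength X h := by
  obtain ⟨w, h1, h2, h3⟩ := wl_spec hX g
  obtain ⟨w', h1', h2', h3'⟩ := wl_spec hX h
  have := wl_le (X := X) (w ++ w') (fun a ha => by
    rcases List.mem_append.1 ha with ha | ha
    · exact h2 a ha
    · exact h2' a ha)
  rwa [List.prod_append, h3, h3', List.length_append, h1, h1'] at this

theorem wl_inv {G : Type} [Group G] {X : Finset G} (hX : Generates X) (g : G) :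
    wordLength X g⁻¹ ≤ wordLength X g := by
  obtain ⟨w, h1, h2, h3⟩ := wl_spec hX g
  have := wl_le (X := X) (w.map (·⁻¹)).reverse (fun a ha => by
    simp only [List.mem_reverse, List.mem_map] at ha
    obtain ⟨b, hb, rfl⟩ := ha
    rw [inv_inv]
    exact (h2 b hb).symm)
  rwa [← List.prod_inv_reverse, h3, List.length_reverse, List.length_map, h1] at this

theorem wl_hom {G H : Type} [Group G] [Group H] {X : Finset G} {Y : Finset H} (hX : Generates X)
    (hY : Generates Y) (φ : G →* H) :
    ∃ M : ℕ, ∀ g, wordLength Y (φ g) ≤ M * wordLength X g := by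
  refine ⟨X.sup fun x => wordLength Y (φ x), fun g => ?_⟩
  obtain ⟨w, h1, h2, rfl⟩ := wl_spec hX g
  rw [← h1]
  clear h1
  induction w with
  | nil =>
    have := wl_le (X := Y) [] (by simp)
    simpa using this
  | cons a w ih =>
    rw [List.prod_cons, map_mul]
    refine (wl_mul hY _ _).trans ?_
    have i1 := ih fun b hb => h2 b (by simp [hb])
    have i2 : wordLength Y (φ a) ≤ X.sup fun x => wordLength Y (φ x) := by
      rcases h2 a (by simp) with h | h
      · exact Finset.le_sup (f := fun x => wordLength Y (φ x)) h
      · have := wl_inv hY (φ a⁻¹)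
        rw [map_inv, inv_inv] at this
        rw [← map_inv] at this
        exact this.trans (Finset.le_sup (f := fun x => wordLength Y (φ x)) h)
    rw [List.length_cons, Nat.mul_add]
    omega

theorem project_list {Γ G : Type} [Group Γ] [Group G] {act : Γ →* Qa}
    (hinj : Function.Injective act) (π : Γ →* G) {X : Finset G} {F0 : Set Qa}
    (hF : ∀ x ∈ F0, ∃ γ, act γ = x ∧ (π γ ∈ X ∨ π γ = 1)) (l : List Qa)
    (hl : ∀ x ∈ l, x ∈ F0 ∨ x⁻¹ ∈ F0 ∨ x = 1) :
    ∃ l' : List G, l'.length ≤ l.length ∧ (∀ a ∈ l', a ∈ X ∨ a⁻¹ ∈ X) ∧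
      ∀ γ, act γ = l.prod → π γ = l'.prod := by
  induction l with
  | nil =>
    refine ⟨[], le_rfl, by simp, fun γ h => ?_⟩
    have : γ = 1 := hinj (by rw [h, map_one]; rfl)
    rw [this, map_one]; rfl
  | cons x l ih =>
    obtain ⟨l', h1, h2, h3⟩ := ih fun y hy => hl y (by simp [hy])
    obtain ⟨γx, hγ, hπ⟩ : ∃ γ, act γ = x ∧ ((π γ ∈ X ∨ (π γ)⁻¹ ∈ X) ∨ π γ = 1) := by
      rcases hl x (by simp) with h | h | h
      · obtain ⟨γ, h4, h5⟩ := hF x h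
        exact ⟨γ, h4, by tauto⟩
      · obtain ⟨γ, h4, h5⟩ := hF _ h
        refine ⟨γ⁻¹, by rw [map_inv, h4, inv_inv], ?_⟩
        rw [map_inv, inv_inv, inv_eq_one]
        tauto
      · exact ⟨1, by rw [h, map_one], Or.inr (map_one _)⟩
    have key : ∀ γ, act γ = (x :: l).prod → π γ = π γx * l'.prod := by
      intro γ h
      rw [List.prod_cons, ← hγ] at h
      have := h3 (γx⁻¹ * γ) (by rw [map_mul, map_inv, h, inv_mul_cancel_left])
      rw [← this, map_mul, map_inv, mul_inv_cancel_left]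
    rcases hπ with hπ | hπ
    · refine ⟨π γx :: l', by simpa using h1, ?_, by simpa using key⟩
      intro a ha
      rcases List.mem_cons.1 ha with rfl | ha
      · exact hπ
      · exact h2 a ha
    · refine ⟨l', h1.trans (by simp), h2, fun γ h => ?_⟩
      rw [key γ h, hπ, one_mul]

end FL

theorem family_qi_frattini_embedding_into_fg_leftOrderable_simple
    (G : ℕ → Type) [∀ i, Group (G i)] (hfg : ∀ i, Group.FG (G i))
    (hlo : ∀ i, IsLeftOrderable (G i)) :
    ∃ (H : Type) (_ : Group H), Group.FG H ∧ IsLeftOrderable H ∧ IsSimpleGroup H ∧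
      ∀ i, ∃ (X : Finset (G i)) (Y : Finset H) (φ : G i →* H),
        Generates X ∧ Generates Y ∧ IsQIEmbedding X Y φ ∧ IsFrattini φ := by
  classical
  choose X hX using fun i => (hfg i).out
  let gens : Set (∀ i, G i) := ⋃ i, (fun x => Pi.mulSingle i x) '' (X i : Set (G i))
  have hgc : gens.Countable := Set.countable_iUnion fun i => (X i).countable_toSet.image _
  let Γ : Subgroup (∀ i, G i) := Subgroup.closure gens
  haveI : Countable Γ := FL.countable_closure hgc
  obtain ⟨act, hact⟩ := FL.free_act Γ (FL.lo_pi G hlo Γ)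
  have hinj : Function.Injective act := by
    rw [injective_iff_map_eq_one]
    intro g hg
    exact hact g 0 (by rw [hg]; rfl)
  let g0 : Set Γ := Subtype.val ⁻¹' gens
  have hg0 : Subgroup.closure g0 = ⊤ := Subgroup.closure_closure_coe_preimage
  let F0 : Set FL.Qa := act '' g0
  have hcl : Subgroup.closure F0 = act.range := by
    rw [← MonoidHom.map_closure, hg0, MonoidHom.range_eq_map]
  have hmem : ∀ γ, act γ ∈ Subgroup.closure F0 := fun γ => by rw [hcl]; exact ⟨γ, rfl⟩
  obtain ⟨Y, hsimp, hPhi, hword, hfrat⟩ := FL.core F0 (Set.to_countable g0 |>.image _) (by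
    intro σ hσ a ha
    rw [hcl] at hσ
    obtain ⟨γ, rfl⟩ := hσ
    rw [hact γ a ha, map_one])
  let Psi : Γ →* Subgroup.closure (Y : Set FL.Au) :=
    (FL.Phi.comp act).codRestrict _ fun γ => hPhi _ (hmem γ)
  have hPsi : ∀ γ, (Psi γ : FL.Au) = FL.Phi (act γ) := fun _ => rfl
  let YH : Finset (Subgroup.closure (Y : Set FL.Au)) := Y.subtype _
  have hYH : ∀ a, a ∈ YH ↔ (a : FL.Au) ∈ Y := fun a => Finset.mem_subtype
  have hYgen : Generates YH := by
    have h1 : (YH : Set (Subgroup.closure (Y : Set FL.Au))) = Subtype.val ⁻¹' (Y : Set FL.Au) := by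
      ext a
      exact hYH a
    unfold Generates
    rw [h1]
    exact Subgroup.closure_closure_coe_preimage
  refine ⟨Subgroup.closure (Y : Set FL.Au), inferInstance, ⟨⟨YH, hYgen⟩⟩, FL.lo_au _, hsimp, ?_⟩
  intro i
  have hsingle : ∀ x : G i, MonoidHom.mulSingle G i x ∈ Γ := by
    intro x
    have hx : x ∈ Subgroup.closure (X i : Set (G i)) := by rw [hX]; trivial
    have h1 := Subgroup.mem_map_of_mem (MonoidHom.mulSingle G i) hx
    rw [MonoidHom.map_closure] at h1
    exact Subgroup.closure_mono (Set.subset_iUnion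
      (fun i => (fun x => Pi.mulSingle i x) '' (X i : Set (G i))) i) h1
  let ι : G i →* Γ := (MonoidHom.mulSingle G i).codRestrict Γ hsingle
  let π : Γ →* G i := (Pi.evalMonoidHom G i).comp Γ.subtype
  have hπι : ∀ x, π (ι x) = x := fun x => Pi.mulSingle_eq_same i x
  have hφinj : Function.Injective (Psi.comp ι) := by
    intro a b h
    have h1 : FL.Phi (act (ι a)) = FL.Phi (act (ι b)) := congrArg Subtype.val h
    rw [← hπι a, hinj (FL.Phi_inj h1), hπι]
  refine ⟨X i, YH, Psi.comp ι, hX i, hYgen, ⟨hφinj, ?_⟩, hφinj, ?_⟩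
  · obtain ⟨M, hM⟩ := FL.wl_hom (hX i) hYgen (Psi.comp ι)
    refine ⟨M + 1, 1, by positivity, one_pos, fun g => ⟨?_, ?_⟩⟩
    · have hlow : wordLength (X i) g ≤ wordLength YH (Psi.comp ι g) := by
        obtain ⟨w, hw1, hw2, hw3⟩ := FL.wl_spec hYgen (Psi.comp ι g)
        obtain ⟨l, hl1, hl2, hl3⟩ := hword (act (ι g)) (hmem _) (w.map Subtype.val) (by
            intro a ha
            obtain ⟨b, hb, rfl⟩ := List.mem_map.1 ha
            rcases hw2 b hb with h | h
            · exact Or.inl ((hYH _).1 h)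
            · exact Or.inr ((hYH _).1 h)) (by
            have := congrArg (Subgroup.closure (Y : Set FL.Au)).subtype hw3
            rw [map_list_prod] at this
            exact this)
        obtain ⟨l', h1, h2, h3⟩ := FL.project_list hinj π (X := X i) (F0 := F0) (by
          rintro _ ⟨γ, hγ, rfl⟩
          refine ⟨γ, rfl, ?_⟩
          obtain ⟨k, x, hx, hk⟩ := Set.mem_iUnion.1 hγ
          have hpk : π γ = (Pi.mulSingle k x : ∀ i, G i) i := by
            exact (congrFun hk i).symm
          rw [hpk]
          by_cases hik : i = k
          · subst hik
            rw [Pi.mulSingle_eq_same]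
            exact Or.inl hx
          · exact Or.inr (Pi.mulSingle_eq_of_ne hik x)) l hl2
        have h4 := h3 (ι g) hl3.symm
        rw [hπι] at h4
        rw [h4]
        refine (FL.wl_le l' h2).trans ?_
        rw [← h4, ← hw1]
        rw [hl1, List.length_map] at h1
        exact h1
      have h5 : (wordLength (X i) g : ℝ) ≤ wordLength YH (Psi.comp ι g) := by exact_mod_cast hlow
      have h6 : 1 / ((M : ℝ) + 1) ≤ 1 := by
        rw [div_le_one (by positivity)]
        linarith [(Nat.cast_nonneg M : (0 : ℝ) ≤ M)]
      have h7 := mul_le_mul_of_nonneg_right h6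
        (Nat.cast_nonneg (wordLength (X i) g) : (0 : ℝ) ≤ wordLength (X i) g)
      linarith
    · have h1 : (wordLength YH (Psi.comp ι g) : ℝ) ≤ M * wordLength (X i) g := by
        exact_mod_cast hM g
      have h2 : (0 : ℝ) ≤ wordLength (X i) g := Nat.cast_nonneg _
      linarith
  · intro a b
    constructor
    · intro h
      exact (Psi.comp ι).map_isConj h
    · intro h
      obtain ⟨c, hc⟩ := isConj_iff.1 h
      have hc' : c * Psi (ι a) = Psi (ι b) * c := by
        have : c * Psi (ι a) * c⁻¹ = Psi (ι b) := hc
        rw [← this, inv_mul_cancel_right]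
      obtain ⟨d, hd, hde⟩ := hfrat _ (hmem (ι a)) _ (hmem (ι b)) c c.2 (congrArg Subtype.val hc')
      rw [hcl] at hd
      obtain ⟨γ, rfl⟩ := hd
      rw [← map_mul, ← map_mul] at hde
      have h1 := congrArg π (hinj hde)
      rw [map_mul, map_mul, hπι, hπι] at h1
      exact isConj_iff.2 ⟨π γ, by rw [h1, mul_inv_cancel_right]⟩
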